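/- Let G be a finite non-solvable group. Then α(G) ≤ 67/120 = α(S₅), with equality if and only if G ≅ S₅ × C₂ⁿ for some integer n ≥ 0. -/

import Mathlib

open scoped Classical

/-- The number of cyclic subgroups of a group. -/
noncomputable def numCyclic (G : Type*) [Group G] : ℕ :=
  Nat.card {H : Subgroup G // IsCyclic (↥H)}

/-- `alpha G = c(G) / |G|`, the number of cyclic subgroups divided by the order. -/
noncomputable def alpha (G : Type*) [Group G] : ℚ :=
  (numCyclic G : ℚ) / (Nat.card G : ℚ)

theorem exists_forall_eq_of_isIntegral_sum_div_card {s : Multiset ℂ} {N : ℕ} (hN : 0 < N)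
    (hs : ∀ μ ∈ s, μ ^ N = 1) (hint : IsIntegral ℤ (s.sum / Multiset.card s)) (hne : s.sum ≠ 0) :
    ∃ a : ℂ, ∀ μ ∈ s, μ = a := by
  have hs0 : 0 < Multiset.card s := by
    rw [Multiset.card_pos]; rintro rfl; simp at hne
  have hcard : (Multiset.card s : ℂ) ≠ 0 := by exact_mod_cast hs0.ne'
  obtain ⟨ζ, hζ⟩ : ∃ ζ : ℂ, IsPrimitiveRoot ζ N := ⟨_, Complex.isPrimitiveRoot_exp N hN.ne'⟩
  have : NeZero N := ⟨hN.ne'⟩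
  have hζint : IsIntegral ℚ ζ := (hζ.isIntegral hN).tower_top
  let K := IntermediateField.adjoin ℚ {ζ}
  have : FiniteDimensional ℚ K := IntermediateField.adjoin.finiteDimensional hζint
  have : NumberField K := ⟨⟩
  have hmem : ∀ μ ∈ s, μ ∈ K := by
    intro μ hμ
    obtain ⟨i, -, rfl⟩ := hζ.eq_pow_of_pow_eq_one (hs μ hμ)
    exact pow_mem (IntermediateField.mem_adjoin_simple_self ℚ ζ) i
  obtain ⟨t, rfl⟩ : ∃ t : Multiset K, t.map (algebraMap K ℂ) = s :=
    ⟨s.attach.map fun μ ↦ ⟨μ.1, hmem μ.1 μ.2⟩, by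
      rw [Multiset.map_map]
      exact Multiset.attach_map_val s⟩
  have norm_le : ∀ φ : K →+* ℂ, ‖φ (t.sum / Multiset.card t)‖ ≤ 1 := by
    intro φ
    have h1 : ∀ x ∈ t, ‖φ x‖ = 1 := by
      intro x hx
      have h2 := hs _ (Multiset.mem_map_of_mem _ hx)
      rw [← map_pow, map_eq_one_iff _ (algebraMap K ℂ).injective] at h2
      have h3 : φ x ^ N = 1 := by rw [← map_pow, h2, map_one]
      exact Complex.norm_eq_one_of_pow_eq_one h3 hN.ne'
    rw [map_div₀, map_natCast, norm_div, Complex.norm_natCast, map_multiset_sum]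
    simp only [Multiset.card_map] at hs0
    rw [div_le_one (by exact_mod_cast hs0)]
    refine (norm_multiset_sum_le _).trans ?_
    rw [Multiset.map_map, Multiset.map_congr rfl (f := (fun x : ℂ ↦ ‖x‖) ∘ φ) (g := fun _ ↦ (1 : ℝ)) (fun x hx ↦ h1 x hx)]
    simp
  have halg : algebraMap K ℂ (t.sum / Multiset.card t) =
      (t.map (algebraMap K ℂ)).sum / Multiset.card (t.map (algebraMap K ℂ)) := by
    rw [map_div₀, map_natCast, map_multiset_sum, Multiset.card_map]
  obtain ⟨n, hn, hpow⟩ := NumberField.Embeddings.pow_eq_one_of_norm_le_one K ℂ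
    (x := t.sum / Multiset.card t) (by
      intro h0
      rw [h0, map_zero, eq_comm, div_eq_zero_iff] at halg
      exact halg.elim hne hcard)
    (by rw [← halg] at hint; exact (isIntegral_algebraMap_iff (algebraMap K ℂ).injective).1 hint)
    norm_le
  set a := algebraMap K ℂ (t.sum / Multiset.card t) with ha
  have ha1 : ‖a‖ = 1 := Complex.norm_eq_one_of_pow_eq_one (by rw [ha, ← map_pow, hpow, map_one]) hn.ne'
  clear_value a
  set s := t.map (algebraMap K ℂ) with hs'
  clear_value s
  have hmu : ∀ μ ∈ s, ‖μ‖ = 1 := fun μ hμ ↦ Complex.norm_eq_one_of_pow_eq_one (hs μ hμ) hN.ne'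
  have hre : ∀ μ ∈ s, ((starRingEnd ℂ) a * μ).re ≤ 1 := fun μ hμ ↦ by
    refine (Complex.re_le_norm _).trans ?_
    rw [norm_mul, hmu μ hμ]; simp [ha1]
  have haa : (starRingEnd ℂ) a * a = 1 := by
    rw [← Complex.normSq_eq_conj_mul_self, Complex.normSq_eq_norm_sq, ha1]; simp
  have hsum : (s.map fun μ ↦ 1 - ((starRingEnd ℂ) a * μ).re).sum = 0 := by
    have h1 : s.sum = Multiset.card s * a := by rw [halg]; field_simp
    have h2 : (s.map fun μ ↦ ((starRingEnd ℂ) a * μ).re).sum = Multiset.card s := by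
      have : (s.map fun μ ↦ ((starRingEnd ℂ) a * μ).re).sum = ((starRingEnd ℂ) a * s.sum).re := by
        clear * -
        induction s using Multiset.induction_on with
        | empty => simp
        | cons b s ih => simp only [Multiset.map_cons, Multiset.sum_cons, ih, mul_add, Complex.add_re]
      rw [this, h1, mul_left_comm, haa]; simp
    rw [Multiset.sum_map_sub, h2]; simp
  refine ⟨a, fun μ hμ ↦ ?_⟩
  have h0 : 1 - ((starRingEnd ℂ) a * μ).re = 0 := by
    refine le_antisymm ?_ (by linarith [hre μ hμ])
    rw [← hsum]
    refine Multiset.single_le_sum ?_ _ (Multiset.mem_map_of_mem _ hμ)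
    intro x hx
    obtain ⟨ν, hν, rfl⟩ := Multiset.mem_map.1 hx
    linarith [hre ν hν]
  have h3 : (starRingEnd ℂ) a * μ = 1 := by
    have hn1 : ‖(starRingEnd ℂ) a * μ‖ = 1 := by rw [norm_mul, hmu μ hμ]; simp [ha1]
    have h5 : ((starRingEnd ℂ) a * μ).re = 1 := by linarith
    have := Complex.re_eq_norm.1 (h5.trans hn1.symm)
    apply Complex.ext
    · simpa using h5
    · simpa using this.2.symm
  have : a * ((starRingEnd ℂ) a * μ) = a := by rw [h3, mul_one]
  rw [← mul_assoc, mul_comm a, haa, one_mul] at this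
  exact this

theorem Matrix.eq_algebraMap_of_pow_eq_one {d N : ℕ} (hN : 0 < N)
    {A : Matrix (Fin d) (Fin d) ℂ} (hA : A ^ N = 1) {a : ℂ} (ha : ∀ μ ∈ A.charpoly.roots, μ = a) :
    A = algebraMap ℂ _ a := by
  rcases Nat.eq_zero_or_pos d with rfl | hd
  · exact Subsingleton.elim _ _
  open Polynomial in
  have hdvd : minpoly ℂ A ∣ X ^ N - 1 := minpoly.dvd _ _ (by simp [hA])
  have hsq : Squarefree (minpoly ℂ A) := by
    refine Squarefree.squarefree_of_dvd hdvd ?_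
    have : (X ^ N - C 1 : ℂ[X]).Separable :=
      separable_X_pow_sub_C _ (by exact_mod_cast hN.ne') one_ne_zero
    simpa using this.squarefree
  have hchar : A.charpoly = (X - C a) ^ Multiset.card A.charpoly.roots := by
    conv_lhs => rw [(IsAlgClosed.splits A.charpoly).eq_prod_roots_of_monic A.charpoly_monic,
      Multiset.map_congr rfl (g := fun _ ↦ X - C a) (fun μ hμ ↦ by rw [ha μ hμ])]
    simp
  have h1 : minpoly ℂ A ∣ (X - C a) ^ Multiset.card A.charpoly.roots := by
    rw [← hchar]; exact A.minpoly_dvd_charpoly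
  have h2 : minpoly ℂ A ∣ X - C a := by
    refine (hsq.dvd_pow_iff_dvd ?_).1 h1
    rw [← (IsAlgClosed.splits A.charpoly).natDegree_eq_card_roots, A.charpoly_natDegree_eq_dim]
    simpa using hd.ne'
  have h3 : aeval A (X - C a) = 0 := by
    obtain ⟨q, hq⟩ := h2
    rw [hq, map_mul, minpoly.aeval, zero_mul]
  simpa [sub_eq_zero] using h3

theorem trace_mulLeft_pi_matrix {n : ℕ} {d : Fin n → ℕ}
    (A : ∀ i, Matrix (Fin (d i)) (Fin (d i)) ℂ) :
    LinearMap.trace ℂ _ (LinearMap.mulLeft ℂ A) = ∑ i, (d i : ℂ) * (A i).trace := by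
  rw [LinearMap.trace_eq_matrix_trace ℂ (Pi.basis fun i ↦ Matrix.stdBasis ℂ (Fin (d i)) (Fin (d i)))]
  simp only [Matrix.trace, Matrix.diag_apply, LinearMap.toMatrix_apply, Fintype.sum_sigma,
    Fintype.sum_prod_type]
  refine Finset.sum_congr rfl fun i _ ↦ ?_
  rw [Finset.mul_sum]
  refine Finset.sum_congr rfl fun j _ ↦ ?_
  simp [Pi.basis_repr, Pi.basis_apply, Matrix.stdBasis, Matrix.mul_apply, Pi.single_apply, ite_apply]

theorem trace_mulLeft_of {G : Type*} [Group G] [Finite G] {x : G} (hx : x ≠ 1) :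
    LinearMap.trace ℂ _ (LinearMap.mulLeft ℂ (MonoidAlgebra.of ℂ G x)) = 0 := by
  have := Fintype.ofFinite G
  rw [LinearMap.trace_eq_matrix_trace ℂ (MonoidAlgebra.basis G ℂ), Matrix.trace]
  refine Finset.sum_eq_zero fun i _ ↦ ?_
  rw [Matrix.diag_apply, LinearMap.toMatrix_apply]
  simp [MonoidAlgebra.basis, MonoidAlgebra.single_mul_single, hx]

theorem Matrix.isIntegral_trace_of_pow_eq_one {d N : ℕ} (hN : 0 < N)
    {A : Matrix (Fin d) (Fin d) ℂ} (hA : A ^ N = 1) :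
    (∀ μ ∈ A.charpoly.roots, μ ^ N = 1) ∧ IsIntegral ℤ A.trace := by
  have h : ∀ μ ∈ A.charpoly.roots, μ ^ N = 1 := by
    intro μ hμ
    rw [Polynomial.mem_roots A.charpoly_monic.ne_zero, ← Matrix.mem_spectrum_iff_isRoot_charpoly] at hμ
    have h1 := spectrum.pow_mem_pow A N hμ
    rw [hA] at h1
    rcases subsingleton_or_nontrivial (Matrix (Fin d) (Fin d) ℂ) with hs | hs
    · simp [spectrum.of_subsingleton] at h1
    · simpa [spectrum.one_eq] using h1
  refine ⟨h, ?_⟩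
  rw [A.trace_eq_sum_roots_charpoly]
  refine IsIntegral.multiset_sum fun μ hμ ↦ IsIntegral.of_pow hN ?_
  rw [h μ hμ]; exact isIntegral_one

/-- Burnside: a finite simple group with a nontrivial conjugacy class of prime power order is commutative. -/
theorem IsSimpleGroup.comm_of_card_conj_eq_prime_pow {G : Type*} [Group G] [Finite G]
    [IsSimpleGroup G] {p k : ℕ} (hp : p.Prime) {g : G} (hg : g ≠ 1)
    (hcard : Nat.card {x : G // IsConj g x} = p ^ k) : ∀ a b : G, a * b = b * a := by
  by_contra hcomm
  have := Fintype.ofFinite G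
  have hss : IsSemisimpleRing (MonoidAlgebra ℂ G) := inferInstance
  obtain ⟨n, d, hd, ⟨e⟩⟩ :=
    IsSemisimpleRing.exists_algEquiv_pi_matrix_of_isAlgClosed ℂ (MonoidAlgebra ℂ G)
  let ρ (i : Fin n) : G →* Matrix (Fin (d i)) (Fin (d i)) ℂ :=
    { toFun := fun x ↦ e (MonoidAlgebra.of ℂ G x) i
      map_one' := by rw [map_one, map_one]; rfl
      map_mul' := fun x y ↦ by rw [map_mul, map_mul]; rfl }
  have hρ (i : Fin n) (x : G) : ρ i x = e (MonoidAlgebra.of ℂ G x) i := rfl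
  have hdpos (i : Fin n) : (d i : ℂ) ≠ 0 := by exact_mod_cast (hd i).out
  have htr {x : G} (hx : x ≠ 1) : ∑ i, (d i : ℂ) * (ρ i x).trace = 0 := by
    rw [← trace_mulLeft_of hx, ← LinearMap.trace_conj' _ e.toLinearEquiv,
      ← trace_mulLeft_pi_matrix fun i ↦ ρ i x]
    congr 1
    refine LinearMap.ext fun v ↦ ?_
    rw [LinearEquiv.conj_apply_apply]
    change (fun i ↦ ρ i x) * v = e (MonoidAlgebra.of ℂ G x * e.symm v)
    rw [map_mul, AlgEquiv.apply_symm_apply]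
    rfl
  have hscalar {z : MonoidAlgebra ℂ G} (hz : ∀ x : G, MonoidAlgebra.of ℂ G x * z = z * MonoidAlgebra.of ℂ G x)
      (i : Fin n) : ∃ ω : ℂ, e z i = algebraMap ℂ _ ω := by
    have hz' (y : MonoidAlgebra ℂ G) : y * z = z * y := by
      induction y using MonoidAlgebra.induction_on with
      | of x => exact hz x
      | add x y hx hy => rw [add_mul, mul_add, hx, hy]
      | smul r x hx => rw [smul_mul_assoc, mul_smul_comm, hx]
    have hc (B : Matrix (Fin (d i)) (Fin (d i)) ℂ) : Commute B (e z i) := by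
      have := congrArg (fun w ↦ e w i) (hz' (e.symm (Pi.single i B)))
      simpa [Commute, SemiconjBy] using this
    obtain ⟨ω, hω⟩ := Matrix.mem_range_scalar_of_commute_single (M := e z i) fun j k _ ↦ hc _
    exact ⟨ω, hω.symm⟩
  have hone {i : Fin n} (hi : ∀ x, ρ i x = 1) (y : MonoidAlgebra ℂ G) :
      e y i = algebraMap ℂ _ (MonoidAlgebra.lift ℂ ℂ G 1 y) := by
    induction y using MonoidAlgebra.induction_on with
    | of x => rw [← hρ, hi]; simp
    | add x y hx hy => rw [map_add, Pi.add_apply, hx, hy, map_add, map_add]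
    | smul r x hx => rw [map_smul, Pi.smul_apply, hx, map_smul, Algebra.smul_def, smul_eq_mul, map_mul]
  have htriv {i : Fin n} (hi : ∀ x, ρ i x = 1) : (d i : ℂ) = 1 := by
    have hle : d i ≤ 1 := by
      by_contra! h
      have h1 := hone hi (e.symm (Pi.single i (Matrix.single ⟨0, by omega⟩ ⟨1, h⟩ 1)))
      have h2 := congrFun (congrFun h1 ⟨0, by omega⟩) ⟨1, h⟩
      simp [Matrix.algebraMap_matrix_apply] at h2
    have := Nat.pos_of_ne_zero (hd i).out
    exact_mod_cast (by omega : d i = 1)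
  have huniq {i j : Fin n} (hi : ∀ x, ρ i x = 1) (hj : ∀ x, ρ j x = 1) : i = j := by
    by_contra hij
    have h1 := hone hi (e.symm (Pi.single i 1))
    have h2 := hone hj (e.symm (Pi.single i 1))
    have := hd i
    have := hd j
    rw [AlgEquiv.apply_symm_apply, Pi.single_eq_same] at h1
    rw [AlgEquiv.apply_symm_apply, Pi.single_eq_of_ne (Ne.symm hij)] at h2
    have h3 := (map_eq_zero_iff _ (algebraMap ℂ (Matrix (Fin (d j)) (Fin (d j)) ℂ)).injective).1 h2.symm
    rw [h3, map_zero] at h1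
    exact one_ne_zero h1
  obtain ⟨i₀, hi₀⟩ : ∃ i, ∀ x, ρ i x = 1 := by
    let s : MonoidAlgebra ℂ G := ∑ x, MonoidAlgebra.of ℂ G x
    have hs1 (x : G) : MonoidAlgebra.of ℂ G x * s = s := by
      rw [Finset.mul_sum]
      simp_rw [← map_mul]
      exact Fintype.sum_equiv (Equiv.mulLeft x) _ _ fun y ↦ rfl
    have hs2 (x : G) : s * MonoidAlgebra.of ℂ G x = s := by
      rw [Finset.sum_mul]
      simp_rw [← map_mul]
      exact Fintype.sum_equiv (Equiv.mulRight x) _ _ fun y ↦ rfl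
    have hs0 : s ≠ 0 := by
      intro h
      have := congrArg (MonoidAlgebra.lift ℂ ℂ G 1) h
      simp [s] at this
    obtain ⟨i, hi⟩ : ∃ i, e s i ≠ 0 := by
      by_contra! h
      exact hs0 ((map_eq_zero_iff e e.injective).1 (funext h))
    obtain ⟨ω, hω⟩ := hscalar (z := s) (fun x ↦ by rw [hs1, hs2]) i
    have hω0 : ω ≠ 0 := by rintro rfl; exact hi (by rw [hω, map_zero])
    refine ⟨i, fun x ↦ ?_⟩
    have h1 := congrArg (fun w ↦ e w i) (hs1 x)
    simp only [map_mul, Pi.mul_apply, hω, ← hρ] at h1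
    rw [← Algebra.commutes, ← Algebra.smul_def, Algebra.algebraMap_eq_smul_one] at h1
    exact smul_right_injective _ hω0 h1
  have hN : 0 < Nat.card G := Nat.card_pos
  have hpow (i : Fin n) (x : G) : ρ i x ^ Nat.card G = 1 := by rw [← map_pow, pow_card_eq_one', map_one]
  let C : Finset G := Finset.univ.filter (IsConj g)
  have hCcard : (C.card : ℂ) = p ^ k := by
    rw [Nat.card_eq_fintype_card, Fintype.card_subtype] at hcard
    exact_mod_cast hcard
  let z : MonoidAlgebra ℂ G := ∑ x ∈ C, MonoidAlgebra.of ℂ G x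
  have hz (x : G) : MonoidAlgebra.of ℂ G x * z = z * MonoidAlgebra.of ℂ G x := by
    rw [Finset.mul_sum, Finset.sum_mul]
    refine Finset.sum_equiv (MulAut.conj x).toEquiv (fun y ↦ ?_) fun y _ ↦ ?_
    · simp only [C, Finset.mem_filter_univ]
      have : IsConj y ((MulAut.conj x) y) := isConj_iff.2 ⟨x, rfl⟩
      exact ⟨fun h ↦ h.trans this, fun h ↦ h.trans this.symm⟩
    · rw [← map_mul, ← map_mul]; simp
  have hzint : IsIntegral ℤ z := by
    have h1 : IsIntegral ℤ (∑ x ∈ C, MonoidAlgebra.of ℤ G x) := Algebra.IsIntegral.isIntegral _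
    have h2 := h1.map (MonoidAlgebra.mapRingHom G (Int.castRingHom ℂ)).toIntAlgHom
    convert h2
    simp [z]
  have key (i : Fin n) (hi : i ≠ i₀) : p ∣ d i ∨ (ρ i g).trace = 0 := by
    by_contra! h
    obtain ⟨ω, hω⟩ := hscalar hz i
    have := hd i
    have hωint : IsIntegral ℤ ω := by
      have h1 := (hzint.map (e.toAlgHom.restrictScalars ℤ)).map (Pi.evalAlgHom ℤ _ i)
      rw [← isIntegral_algebraMap_iff (algebraMap ℂ (Matrix (Fin (d i)) (Fin (d i)) ℂ)).injective]
      rw [← hω]; exact h1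
    have hωtr : (d i : ℂ) * ω = p ^ k * (ρ i g).trace := by
      have h1 := congrArg Matrix.trace hω
      rw [Matrix.algebraMap_eq_diagonal, Matrix.trace_diagonal, map_sum, Finset.sum_apply,
        Matrix.trace_sum, Finset.sum_congr rfl (g := fun _ ↦ (ρ i g).trace)] at h1
      · simp [hCcard] at h1; exact h1.symm
      · intro x hx
        simp only [C, Finset.mem_filter_univ] at hx
        obtain ⟨c, rfl⟩ := isConj_iff.1 hx
        rw [← hρ, map_mul, Matrix.trace_mul_comm, ← map_mul]
        simp
    have hχ := Matrix.isIntegral_trace_of_pow_eq_one hN (hpow i g)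
    have hcop : IsCoprime (p ^ k : ℤ) (d i : ℤ) := by
      refine IsCoprime.pow_left ?_
      rw [Nat.isCoprime_iff_coprime]
      exact (Nat.Prime.coprime_iff_not_dvd hp).2 h.1
    obtain ⟨u, v, huv⟩ := hcop
    have hint : IsIntegral ℤ ((ρ i g).trace / d i) := by
      have h1 : (ρ i g).trace / d i = u * ω + v * (ρ i g).trace := by
        have huv' : (u : ℂ) * p ^ k + v * d i = 1 := by exact_mod_cast huv
        have h3 : ω = p ^ k * (ρ i g).trace / d i := by
          rw [← hωtr, mul_div_cancel_left₀ _ (hdpos i)]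
        rw [h3]
        have := hdpos i
        field_simp
        linear_combination (-(ρ i g).trace) * huv'
      rw [h1]
      exact ((isIntegral_algebraMap (x := u)).mul hωint).add ((isIntegral_algebraMap (x := v)).mul hχ.2)
    have hroots : (Multiset.card (ρ i g).charpoly.roots) = d i := by
      rw [← (IsAlgClosed.splits (ρ i g).charpoly).natDegree_eq_card_roots,
        (ρ i g).charpoly_natDegree_eq_dim, Fintype.card_fin]
    rw [(ρ i g).trace_eq_sum_roots_charpoly,
      show (d i : ℂ) = (Multiset.card (ρ i g).charpoly.roots : ℂ) by rw [hroots]] at hint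
    obtain ⟨a, ha⟩ := exists_forall_eq_of_isIntegral_sum_div_card hN hχ.1 hint
      (by rw [← (ρ i g).trace_eq_sum_roots_charpoly]; exact h.2)
    have hsc := Matrix.eq_algebraMap_of_pow_eq_one hN (hpow i g) ha
    let Z : Subgroup G :=
      { carrier := {x | ∀ y, ρ i (x * y) = ρ i (y * x)}
        one_mem' := by simp
        mul_mem' := fun {a b} ha hb y ↦ by
          rw [Set.mem_ofPred_eq] at ha hb
          rw [mul_assoc, ha, mul_assoc, hb, mul_assoc]
        inv_mem' := fun {a} ha y ↦ by
          have h1 := ha (a⁻¹ * y * a⁻¹)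
          simpa [mul_assoc] using h1.symm }
    have hZn : Z.Normal := ⟨fun x hx c y ↦ by
      have h1 : ρ i (c * x * c⁻¹) = ρ i x := by
        rw [map_mul, map_mul, ← map_mul, ← hx c, map_mul, mul_assoc, ← map_mul]; simp
      rw [map_mul, h1, map_mul, h1, ← map_mul, ← map_mul, hx y]⟩
    have hgZ : g ∈ Z := fun y ↦ by rw [map_mul, map_mul, hsc, Algebra.commutes]
    have hZtop : Z = ⊤ := hZn.eq_bot_or_eq_top.resolve_left fun hb ↦ hg (by simpa [hb] using hgZ)
    rcases (MonoidHom.normal_ker (ρ i)).eq_bot_or_eq_top with hk | hk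
    · refine hcomm fun a b ↦ (MonoidHom.ker_eq_bot_iff (ρ i)).1 hk ?_
      exact (hZtop ▸ Subgroup.mem_top a : a ∈ Z) b
    · refine hi (huniq (fun x ↦ ?_) hi₀)
      exact MonoidHom.mem_ker.1 (hk ▸ Subgroup.mem_top x)
  have hsum := htr hg
  rw [← Finset.add_sum_erase _ _ (Finset.mem_univ i₀), hi₀ g, htriv hi₀] at hsum
  have htr1 : (1 : Matrix (Fin (d i₀)) (Fin (d i₀)) ℂ).trace = 1 := by
    rw [Matrix.trace_one, Fintype.card_fin, htriv hi₀]
  rw [htr1] at hsum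
  have hp0 : (p : ℂ) ≠ 0 := by exact_mod_cast hp.ne_zero
  have hint : IsIntegral ℤ (-(1 / p : ℂ)) := by
    have h1 : -(1 / p : ℂ) = ∑ i ∈ Finset.univ.erase i₀, (d i : ℂ) * (ρ i g).trace / p := by
      rw [← Finset.sum_div]; field_simp; linear_combination -hsum
    rw [h1]
    refine IsIntegral.sum _ fun i hi ↦ ?_
    rcases key i (Finset.ne_of_mem_erase hi) with ⟨c, hc⟩ | h0
    · rw [show (d i : ℂ) = p * c by rw [hc, Nat.cast_mul], mul_assoc, mul_div_cancel_left₀ _ hp0]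
      exact (isIntegral_algebraMap (x := (c : ℤ))).mul (Matrix.isIntegral_trace_of_pow_eq_one hN (hpow i g)).2
    · rw [h0]; simpa using isIntegral_zero
  have h2 : IsIntegral ℤ (algebraMap ℚ ℂ (1 / p)) := by
    have := hint.neg
    simpa using this
  rw [isIntegral_algebraMap_iff (algebraMap ℚ ℂ).injective] at h2
  obtain ⟨m, hm⟩ := IsIntegrallyClosed.isIntegral_iff.1 h2
  have hpq : (p : ℚ) ≠ 0 := by exact_mod_cast hp.ne_zero
  have h3 : (m * p : ℚ) = 1 := by
    have : (m : ℚ) = 1 / p := by simpa using hm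
    rw [this]; field_simp
  have h4 : m * p = 1 := by exact_mod_cast h3
  have h5 : (p : ℤ) ∣ 1 := ⟨m, by linarith⟩
  exact hp.one_lt.ne' (by exact_mod_cast Int.eq_one_of_dvd_one (by positivity) h5)

theorem card_isConj_eq_index {G : Type*} [Group G] (g : G) :
    Nat.card {x : G // IsConj g x} = (Subgroup.centralizer {g}).index := by
  have h : (Subgroup.centralizer {g}).index = (MulAction.stabilizer (ConjAct G) g).index :=
    (congrArg Subgroup.index (Subgroup.centralizer_eq_comap_stabilizer g)).trans
      (Subgroup.index_comap_of_surjective _ (f := (ConjAct.toConjAct : G ≃* ConjAct G).toMonoidHom)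
        ConjAct.toConjAct.surjective)
  rw [h, MulAction.index_stabilizer, ← Nat.card_coe_set_eq]
  exact Nat.card_congr (Equiv.subtypeEquivRight fun x ↦ by
    rw [ConjAct.mem_orbit_conjAct, isConj_comm])

/-- Burnside's theorem: a finite group whose order has at most two prime divisors is solvable. -/
theorem Group.isSolvable_of_prime_dvd_card {p q : ℕ} (hp : p.Prime) (hq : q.Prime) :
    ∀ (n : ℕ) (G : Type*) [Group G] [Finite G], Nat.card G = n →
      (∀ r : ℕ, r.Prime → r ∣ Nat.card G → r = p ∨ r = q) → Group.IsSolvable G := by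
  intro n
  induction n using Nat.strong_induction_on with
  | _ n ih =>
  intro G _ _ hn hG
  subst hn
  rcases subsingleton_or_nontrivial G with hs | hnt
  · infer_instance
  by_cases hsimple : IsSimpleGroup G
  · obtain ⟨r, s, hr, hs, hrG, hG⟩ : ∃ r s : ℕ, r.Prime ∧ s.Prime ∧ r ∣ Nat.card G ∧
        ∀ t : ℕ, t.Prime → t ∣ Nat.card G → t = r ∨ t = s := by
      obtain ⟨r, hr, hrG⟩ := Nat.exists_prime_and_dvd (Finite.one_lt_card (α := G)).ne'
      rcases hG r hr hrG with rfl | rfl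
      · exact ⟨r, q, hr, hq, hrG, hG⟩
      · exact ⟨r, p, hr, hp, hrG, fun t ht h ↦ (hG t ht h).symm⟩
    have := Fact.mk hr
    obtain ⟨P⟩ : Nonempty (Sylow r G) := inferInstance
    have hPnt : Nontrivial P := by
      rw [← Finite.one_lt_card_iff_nontrivial]
      have := P.dvd_card_of_dvd_card hrG
      exact hr.one_lt.trans_le (Nat.le_of_dvd Nat.card_pos this)
    have := P.isPGroup'.center_nontrivial
    obtain ⟨⟨z, hz⟩, hz1⟩ := exists_ne (1 : Subgroup.center P)
    have hle : (P : Subgroup G) ≤ Subgroup.centralizer {(z : G)} := by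
      intro x hx
      rw [Subgroup.mem_centralizer_singleton_iff]
      have := Subgroup.mem_center_iff.1 hz ⟨x, hx⟩
      exact congrArg Subtype.val this
    have hcop : ¬ r ∣ (Subgroup.centralizer {(z : G)}).index := fun h ↦
      P.not_dvd_index (h.trans (Subgroup.index_dvd_of_le hle))
    obtain ⟨k, hk⟩ : ∃ k, (Subgroup.centralizer {(z : G)}).index = s ^ k :=
      ⟨_, Nat.eq_prime_pow_of_unique_prime_dvd Subgroup.index_ne_zero_of_finite fun {t} ht hd ↦
        (hG t ht (hd.trans (Subgroup.index_dvd_card _))).resolve_left fun h ↦ hcop (h ▸ hd)⟩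
    refine Group.isSolvable_of_comm (IsSimpleGroup.comm_of_card_conj_eq_prime_pow hs (g := (z : G)) ?_
      ((card_isConj_eq_index _).trans hk))
    intro h
    exact hz1 (Subtype.ext (Subtype.ext h))
  · obtain ⟨N, hN, hb, ht⟩ : ∃ N : Subgroup G, N.Normal ∧ N ≠ ⊥ ∧ N ≠ ⊤ := by
      by_contra! h
      exact hsimple ⟨fun H hH ↦ or_iff_not_imp_left.2 (h H hH)⟩
    rw [Group.isSolvable_iff_subgroup_quotient N]
    have hmul := N.card_mul_index
    rw [Subgroup.index] at hmul
    have h1 : 1 < Nat.card N := N.one_lt_card_iff_ne_bot.2 hb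
    have h2 : Nat.card N < Nat.card G := lt_of_le_of_ne N.card_le_card_group fun h ↦
      ht (Subgroup.eq_top_of_card_eq N h)
    have h3 : 0 < Nat.card (G ⧸ N) := Nat.card_pos
    exact ⟨ih _ h2 N rfl fun t ht hd ↦ hG t ht (hd.trans ⟨_, hmul.symm⟩),
      ih _ (by nlinarith) (G ⧸ N) rfl fun t ht hd ↦ hG t ht (hd.trans ⟨_, by rw [← hmul, mul_comm]⟩)⟩

theorem card_zpowers_eq {G : Type*} [Group G] [Fintype G] (x : G) :
    (Finset.univ.filter fun y : G ↦ Subgroup.zpowers y = Subgroup.zpowers x).card =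
      (orderOf x).totient := by
  have h := IsCyclic.card_orderOf_eq_totient (α := Subgroup.zpowers x) (d := orderOf x)
    (by rw [Fintype.card_zpowers])
  rw [← h, ← Finset.card_map (Function.Embedding.subtype _)]
  congr 1
  ext y
  simp only [Finset.mem_filter_univ, Finset.mem_map, Function.Embedding.subtype_apply,
    Subtype.exists, exists_and_right, exists_eq_right, Subgroup.orderOf_mk]
  constructor
  · intro hy
    exact ⟨hy ▸ Subgroup.mem_zpowers y, by rw [← Nat.card_zpowers, hy, Nat.card_zpowers]⟩
  · rintro ⟨hy, ho⟩
    exact Subgroup.eq_of_le_of_card_ge (Subgroup.zpowers_le.2 hy)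
      (by rw [Nat.card_zpowers, Nat.card_zpowers, ho])

theorem numCyclic_eq_sum (G : Type*) [Group G] [Fintype G] :
    (numCyclic G : ℚ) = ∑ x : G, (1 : ℚ) / (orderOf x).totient := by
  let f : G → {H : Subgroup G // IsCyclic H} := fun x ↦ ⟨Subgroup.zpowers x, inferInstance⟩
  rw [← Finset.sum_fiberwise_of_maps_to (t := Finset.univ) (g := f) (fun _ _ ↦ Finset.mem_univ _),
    numCyclic, Nat.card_eq_fintype_card, Fintype.card_eq_sum_ones, Nat.cast_sum]
  refine Finset.sum_congr rfl ?_
  rintro ⟨H, hH⟩ -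
  obtain ⟨x, rfl⟩ := Subgroup.isCyclic_iff_exists_zpowers_eq_top H |>.1 hH
  rw [Finset.sum_congr rfl (g := fun _ ↦ (1 : ℚ) / (orderOf x).totient)]
  · rw [Finset.sum_const, show (Finset.univ.filter fun y ↦ f y = ⟨Subgroup.zpowers x, hH⟩) =
      Finset.univ.filter fun y : G ↦ Subgroup.zpowers y = Subgroup.zpowers x by
        ext y; simp [f], card_zpowers_eq]
    have : ((orderOf x).totient : ℚ) ≠ 0 := by
      exact_mod_cast (Nat.totient_pos.2 (orderOf_pos x)).ne'
    rw [nsmul_eq_mul, Nat.cast_one]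
    field_simp
  · intro y hy
    simp only [Finset.mem_filter_univ, f, Subtype.mk.injEq] at hy
    rw [← Nat.card_zpowers, hy, Nat.card_zpowers]

theorem one_div_totient_le_of_dvd {m n : ℕ} (h : m ∣ n) (hn : 0 < n) :
    (1 : ℚ) / n.totient ≤ 1 / m.totient := by
  have h1 : m.totient ≤ n.totient := Nat.le_of_dvd (Nat.totient_pos.2 hn) (Nat.totient_dvd_of_dvd h)
  have h2 : 0 < m.totient := Nat.totient_pos.2 (Nat.pos_of_dvd_of_pos h hn)
  exact one_div_le_one_div_of_le (by exact_mod_cast h2) (by exact_mod_cast h1)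

theorem sum_comp_mk {G : Type*} [Group G] [Fintype G] (N : Subgroup G) (f : G ⧸ N → ℚ) :
    ∑ x : G, f x = Nat.card N * ∑ y : G ⧸ N, f y := by
  rw [← Finset.sum_fiberwise_of_maps_to (t := Finset.univ) (g := fun x : G ↦ (x : G ⧸ N))
    (fun _ _ ↦ Finset.mem_univ _), Finset.mul_sum]
  refine Finset.sum_congr rfl fun y _ ↦ ?_
  rw [Finset.sum_congr rfl (g := fun _ ↦ f y) (fun x hx ↦ by rw [(Finset.mem_filter.1 hx).2]),
    Finset.sum_const, nsmul_eq_mul]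
  congr 2
  obtain ⟨g, rfl⟩ := QuotientGroup.mk_surjective y
  rw [← Fintype.card_subtype, ← Nat.card_eq_fintype_card]
  refine Nat.card_congr ((Equiv.subtypeEquivRight fun x ↦ ?_).trans (Subgroup.leftCosetEquivSubgroup g))
  rw [eq_comm, QuotientGroup.eq, Set.mem_smul_set_iff_inv_smul_mem]
  rfl

theorem alpha_eq_quotient {G : Type*} [Group G] [Fintype G] (N : Subgroup G) [N.Normal] :
    alpha (G ⧸ N) = (∑ x : G, (1 : ℚ) / (orderOf (x : G ⧸ N)).totient) / Nat.card G := by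
  rw [sum_comp_mk N fun y ↦ (1 : ℚ) / (orderOf y).totient, alpha, numCyclic_eq_sum,
    ← N.card_mul_index, Nat.cast_mul, Subgroup.index]
  have : (Nat.card N : ℚ) ≠ 0 := by exact_mod_cast Nat.card_pos.ne'
  rw [mul_div_mul_left _ _ this]

theorem alpha_le_alpha_quotient {G : Type*} [Group G] [Fintype G] (N : Subgroup G) [N.Normal] :
    alpha G ≤ alpha (G ⧸ N) := by
  rw [alpha_eq_quotient, alpha, numCyclic_eq_sum]
  exact div_le_div_of_nonneg_right (Finset.sum_le_sum fun x _ ↦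
    one_div_totient_le_of_dvd (orderOf_map_dvd (QuotientGroup.mk' N) x) (orderOf_pos x))
    (by positivity)

theorem totient_orderOf_mk_of_alpha_eq {G : Type*} [Group G] [Fintype G] (N : Subgroup G) [N.Normal]
    (h : alpha G = alpha (G ⧸ N)) (x : G) :
    (orderOf x).totient = (orderOf (x : G ⧸ N)).totient := by
  have h0 : (Nat.card G : ℚ) ≠ 0 := by exact_mod_cast Nat.card_pos.ne'
  rw [alpha_eq_quotient, alpha, numCyclic_eq_sum, div_left_inj' h0] at h
  have := (Finset.sum_eq_sum_iff_of_le fun x _ ↦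
    one_div_totient_le_of_dvd (orderOf_map_dvd (QuotientGroup.mk' N) x) (orderOf_pos x)).1 h x
      (Finset.mem_univ x)
  simpa using this

theorem alpha_congr {G H : Type*} [Group G] [Group H] [Fintype G] [Fintype H] (e : G ≃* H) :
    alpha G = alpha H := by
  rw [alpha, alpha, numCyclic_eq_sum, numCyclic_eq_sum, Nat.card_congr e.toEquiv]
  congr 1
  exact Fintype.sum_equiv e.toEquiv _ _ fun x ↦ by simp

theorem totient_orderOf_eq_one_iff {G : Type*} [Group G] {x : G} :
    (orderOf x).totient = 1 ↔ x ^ 2 = 1 := by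
  rw [Nat.totient_eq_one_iff, ← orderOf_dvd_iff_pow_eq_one, Nat.dvd_prime Nat.prime_two]

theorem totient_lcm_of_dvd_two (n : ℕ) {m : ℕ} (hm : m ∣ 2) : (n.lcm m).totient = n.totient := by
  rcases (Nat.dvd_prime Nat.prime_two).1 hm with rfl | rfl
  · simp
  · rcases Nat.even_or_odd n with h | h
    · rw [Nat.lcm_eq_left h.two_dvd]
    · rw [(Nat.coprime_two_right.2 h).lcm_eq_mul, Nat.totient_mul (Nat.coprime_two_right.2 h)]
      simp

theorem alpha_perm_fin_five : alpha (Equiv.Perm (Fin 5)) = 67 / 120 := by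
  have key (x : Equiv.Perm (Fin 5)) : (1 : ℚ) / (orderOf x).totient =
      (1 / 2) + (if x ^ 2 = 1 then 1 / 2 else 0) -
        (if x ^ 5 = 1 ∧ x ≠ 1 then 1 / 4 else 0) := by
    have h : x ^ 2 = 1 ∨ (x ^ 3 = 1 ∧ x ≠ 1) ∨ (x ^ 4 = 1 ∧ x ^ 2 ≠ 1) ∨ (x ^ 5 = 1 ∧ x ≠ 1) ∨
        (x ^ 6 = 1 ∧ x ^ 2 ≠ 1 ∧ x ^ 3 ≠ 1) := by
      revert x
      decide +kernel
    have h5 {m : ℕ} (hm : x ^ m = 1) (hm5 : m.Coprime 5) : ¬ (x ^ 5 = 1 ∧ x ≠ 1) := fun h ↦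
      h.2 (orderOf_eq_one_iff.1 (Nat.eq_one_of_dvd_coprimes hm5 (orderOf_dvd_of_pow_eq_one hm)
        (orderOf_dvd_of_pow_eq_one h.1)))
    have h2 {m : ℕ} (hm : orderOf x = m) (h : m.totient ≠ 1) : ¬ x ^ 2 = 1 := by
      rwa [← totient_orderOf_eq_one_iff, hm]
    rcases h with h | ⟨h, h'⟩ | ⟨h, h'⟩ | ⟨h, h'⟩ | ⟨h, h', h''⟩
    · rw [totient_orderOf_eq_one_iff.2 h, if_pos h, if_neg (h5 h (by decide))]; norm_num
    · have ho := orderOf_eq_prime h h'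
      rw [ho, if_neg (h2 ho (by decide)), if_neg (h5 h (by decide)),
        show Nat.totient 3 = 2 from rfl]
      norm_num
    · have ho := orderOf_eq_prime_pow (p := 2) (n := 1) (x := x) h' h
      rw [ho, if_neg h', if_neg (h5 h (by decide)), show Nat.totient (2 ^ (1 + 1)) = 2 from rfl]
      norm_num
    · have := Fact.mk Nat.prime_five
      have ho := orderOf_eq_prime h h'
      rw [ho, if_neg (h2 ho (by decide)), if_pos ⟨h, h'⟩, show Nat.totient 5 = 4 from rfl]
      norm_num
    · have ho : orderOf x = 6 := by
        have h1 := orderOf_dvd_of_pow_eq_one h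
        have h2 := orderOf_dvd_iff_pow_eq_one.not.2 h'
        have h3 := orderOf_dvd_iff_pow_eq_one.not.2 h''
        have := Nat.le_of_dvd (by norm_num) h1
        interval_cases orderOf x <;> simp_all
      rw [ho, if_neg h', if_neg (h5 h (by decide)), show Nat.totient 6 = 2 from rfl]
      norm_num
  have c2 : (Finset.univ.filter fun x : Equiv.Perm (Fin 5) ↦ x ^ 2 = 1).card = 26 := by
    convert (by decide +kernel :
      (Finset.univ.filter fun x : Equiv.Perm (Fin 5) ↦ x ^ 2 = 1).card = 26)
  have c5 : (Finset.univ.filter fun x : Equiv.Perm (Fin 5) ↦ x ^ 5 = 1 ∧ x ≠ 1).card = 24 := by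
    convert (by decide +kernel :
      (Finset.univ.filter fun x : Equiv.Perm (Fin 5) ↦ x ^ 5 = 1 ∧ x ≠ 1).card = 24)
  have c : Fintype.card (Equiv.Perm (Fin 5)) = 120 := by rw [Fintype.card_perm]; rfl
  rw [alpha, numCyclic_eq_sum, Finset.sum_congr rfl fun x _ ↦ key x, Nat.card_eq_fintype_card,
    Finset.sum_sub_distrib, Finset.sum_add_distrib, ← Finset.sum_filter, ← Finset.sum_filter,
    Finset.sum_const, Finset.sum_const, Finset.sum_const, c2, c5, Finset.card_univ, c]
  norm_num

theorem alpha_prod_of_forall_sq_eq_one (G V : Type*) [Group G] [Group V] [Fintype G] [Fintype V]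
    (hV : ∀ v : V, v ^ 2 = 1) : alpha (G × V) = alpha G := by
  have h0 : (Nat.card V : ℚ) ≠ 0 := by exact_mod_cast Nat.card_pos.ne'
  rw [alpha, alpha, numCyclic_eq_sum, numCyclic_eq_sum, Nat.card_prod, Fintype.sum_prod_type,
    Nat.cast_mul, ← mul_div_mul_right (∑ x : G, (1 : ℚ) / (orderOf x).totient) _ h0,
    Finset.sum_mul]
  congr 1
  refine Finset.sum_congr rfl fun g _ ↦ ?_
  rw [Finset.sum_congr rfl fun v _ ↦ by
    rw [Prod.orderOf_mk, totient_lcm_of_dvd_two _ (orderOf_dvd_of_pow_eq_one (hV v))]]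
  rw [Finset.sum_const, nsmul_eq_mul, Finset.card_univ, Nat.card_eq_fintype_card, mul_comm]

theorem card_sq_eq_one_mul_card_le {G : Type*} [Group G] [Fintype G] (A : Subgroup G)
    (hA : ∀ a ∈ A, ∀ b ∈ A, a * b = b * a) :
    Nat.card {x : G // x ^ 2 = 1} * Nat.card A ≤
      ∑ a : A, Nat.card (Subgroup.centralizer {(a : G)}) := by
  have inv_le (a : A) : Nat.card {g : G // g * a * g⁻¹ = (a : G)⁻¹} ≤
      Nat.card (Subgroup.centralizer {(a : G)}) := by
    rcases isEmpty_or_nonempty {g : G // g * a * g⁻¹ = (a : G)⁻¹} with h | ⟨⟨g₀, h₀⟩⟩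
    · simp
    · refine Nat.card_le_card_of_injective (fun g ↦ ⟨g₀⁻¹ * g.1, ?_⟩) fun g g' h ↦ ?_
      · rw [Subgroup.mem_centralizer_singleton_iff]
        have := g.2.trans h₀.symm
        rw [mul_inv_eq_iff_eq_mul] at this
        rw [mul_assoc, this]
        group
      · simpa [Subtype.ext_iff] using h
  choose! r hr using fun (q : G ⧸ A) (h : ∃ x : G, x ^ 2 = 1 ∧ (x : G ⧸ A) = q) ↦ h
  have hr' (x : {x : G // x ^ 2 = 1}) := hr x ⟨x, x.2, rfl⟩
  have hmem (x : {x : G // x ^ 2 = 1}) : (r (x : G))⁻¹ * x ∈ A := by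
    rw [← QuotientGroup.eq]; exact (hr' x).2
  have hinv (x : {x : G // x ^ 2 = 1}) :
      x * ((r (x : G))⁻¹ * x : G) * (x : G)⁻¹ = ((r (x : G))⁻¹ * x)⁻¹ := by
    have h1 : (r (x : G))⁻¹ = r (x : G) := by
      rw [inv_eq_iff_mul_eq_one, ← sq]; exact (hr' x).1
    have h2 : (x : G)⁻¹ = x := by rw [inv_eq_iff_mul_eq_one, ← sq]; exact x.2
    rw [mul_inv_rev, inv_inv, h1, h2]
    nth_rw 3 [← h2]
    group
  let f : {x : G // x ^ 2 = 1} × A → Σ a : A, {g : G // g * a * g⁻¹ = (a : G)⁻¹} := fun z ↦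
    ⟨⟨_, hmem z.1⟩, z.1 * z.2, by
      have := hA _ z.2.2 _ (hmem z.1)
      rw [← hinv z.1, mul_inv_rev, mul_assoc (z.1 : G), this]
      group⟩
  have hf : Function.Injective f := by
    rintro ⟨x, a⟩ ⟨x', a'⟩ h
    have h1 : (r (x : G))⁻¹ * x = (r (x' : G))⁻¹ * x' := congrArg (fun z ↦ (z.1 : G)) h
    have h2 : (x : G) * a = x' * a' := congrArg (fun z ↦ (z.2 : G)) h
    have h3 : ((x : G) : G ⧸ A) = (x' : G) := by
      rw [← QuotientGroup.mk_mul_of_mem (x : G) a.2, h2, QuotientGroup.mk_mul_of_mem _ a'.2]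
    have h4 : (x : G) = x' := by rw [h3] at h1; exact mul_left_cancel h1
    rw [h4] at h2
    exact Prod.ext (Subtype.ext h4) (Subtype.ext (mul_left_cancel h2))
  have := Nat.card_le_card_of_injective f hf
  rw [Nat.card_prod, Nat.card_sigma] at this
  exact this.trans (Finset.sum_le_sum fun a _ ↦ inv_le a)

theorem card_le_card_sq_eq_one_of_le_alpha {G : Type*} [Group G] [Fintype G]
    (h : 67 / 120 ≤ alpha G) {p : ℕ} (hp : p.Prime) (hp5 : 5 ≤ p) :
    7 * Nat.card G + 30 * Nat.card {x : G // p ∣ orderOf x} ≤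
      60 * Nat.card {x : G // x ^ 2 = 1} := by
  have key (x : G) : (1 : ℚ) / (orderOf x).totient ≤
      (1 / 2) + (if x ^ 2 = 1 then 1 / 2 else 0) - (if p ∣ orderOf x then 1 / 4 else 0) := by
    split_ifs with h1 h2 h2
    · have := Nat.le_of_dvd two_pos (h2.trans (orderOf_dvd_of_pow_eq_one h1))
      omega
    · rw [totient_orderOf_eq_one_iff.2 h1]; norm_num
    · have := one_div_totient_le_of_dvd h2 (orderOf_pos x)
      have h5 : (5 : ℚ) ≤ p := by exact_mod_cast hp5
      rw [Nat.totient_prime hp, Nat.cast_sub hp.one_le] at this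
      refine this.trans (?_ : _ ≤ _)
      rw [div_le_iff₀ (by push_cast; linarith)]
      push_cast
      linarith
    · have h3 : 2 ≤ (orderOf x).totient := by
        have := totient_orderOf_eq_one_iff.not.2 h1
        have := Nat.totient_pos.2 (orderOf_pos x)
        omega
      have h3 : (2 : ℚ) ≤ (orderOf x).totient := by exact_mod_cast h3
      rw [div_le_iff₀ (by linarith)]
      linarith
  have h0 : (0 : ℚ) < Nat.card G := by exact_mod_cast Nat.card_pos
  rw [alpha, numCyclic_eq_sum, le_div_iff₀ h0] at h
  replace h := h.trans (Finset.sum_le_sum fun x _ ↦ key x)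
  rw [Finset.sum_sub_distrib, Finset.sum_add_distrib, ← Finset.sum_filter, ← Finset.sum_filter,
    Finset.sum_const, Finset.sum_const, Finset.sum_const, Finset.card_univ,
    ← Fintype.card_subtype, ← Fintype.card_subtype, ← Nat.card_eq_fintype_card,
    ← Nat.card_eq_fintype_card, ← Nat.card_eq_fintype_card] at h
  simp only [nsmul_eq_mul] at h
  have : (7 * Nat.card G + 30 * Nat.card {x : G // p ∣ orderOf x} : ℚ) ≤
      60 * Nat.card {x : G // x ^ 2 = 1} := by linarith
  exact_mod_cast this

theorem pred_mul_card_centralizer_le {G : Type*} [Group G] [Finite G] {p k : ℕ}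
    (hp : p.Prime) {y : G} (hy : y ≠ 1) (hk : y ^ p ^ k = 1) :
    (p - 1) * Nat.card (Subgroup.centralizer {y}) ≤
      p * Nat.card {x : G // p ∣ orderOf x ∧ x ∈ Subgroup.centralizer {y}} := by
  have hpy : p ≤ orderOf y := by
    obtain ⟨j, -, hj⟩ := (Nat.dvd_prime_pow hp).1 (orderOf_dvd_of_pow_eq_one hk)
    rw [hj]
    refine Nat.le_self_pow (fun h ↦ hy ?_) p
    rwa [h, pow_zero, orderOf_eq_one_iff] at hj
  have hzy (z : Subgroup.zpowers y) : (z : G) ∈ Subgroup.centralizer {y} := by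
    obtain ⟨i, hi⟩ := z.2
    rw [Subgroup.mem_centralizer_singleton_iff, ← hi]
    exact ((Commute.refl y).zpow_left i).eq
  let f : {x : G // ¬ p ∣ orderOf x ∧ x ∈ Subgroup.centralizer {y}} × Subgroup.zpowers y →
      Subgroup.centralizer {y} := fun z ↦ ⟨z.1 * z.2, mul_mem z.1.2.2 (hzy z.2)⟩
  have hf : Function.Injective f := by
    rintro ⟨⟨x, hx, hxy⟩, z⟩ ⟨⟨x', hx', hxy'⟩, z'⟩ h
    have h1 : x * z = x' * z' := congrArg Subtype.val h
    obtain ⟨i, hi⟩ := (z * z'⁻¹).2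
    have h2 : x' = x * y ^ i := by
      simp only [hi, Subgroup.coe_mul, Subgroup.coe_inv]
      rw [← mul_assoc, h1, mul_inv_cancel_right]
    have hc : Commute x (y ^ i) :=
      Commute.zpow_right (Subgroup.mem_centralizer_singleton_iff.1 hxy) i
    have h3 : (y ^ i) ^ (orderOf x * orderOf x') = 1 := by
      have h4 := hc.mul_pow (orderOf x * orderOf x')
      rw [← h2, pow_mul x, pow_orderOf_eq_one, one_pow, one_mul, mul_comm, pow_mul,
        pow_orderOf_eq_one, one_pow] at h4
      rw [mul_comm, ← h4]
    have h5 : (y ^ i) ^ p ^ k = 1 := by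
      rw [← zpow_natCast, ← zpow_mul, mul_comm, zpow_mul, zpow_natCast, hk, one_zpow]
    have h6 : y ^ i = 1 := by
      rw [← orderOf_eq_one_iff]
      refine Nat.eq_one_of_dvd_coprimes (Nat.Coprime.pow_left k ?_)
        (orderOf_dvd_of_pow_eq_one h5) (orderOf_dvd_of_pow_eq_one h3)
      exact Nat.Coprime.mul_right ((Nat.Prime.coprime_iff_not_dvd hp).2 hx)
        ((Nat.Prime.coprime_iff_not_dvd hp).2 hx')
    rw [h6, mul_one] at h2
    subst h2
    exact Prod.ext rfl (Subtype.ext (mul_left_cancel h1))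
  have h1 := Nat.card_le_card_of_injective f hf
  rw [Nat.card_prod, Nat.card_zpowers] at h1
  have h2 : Nat.card (Subgroup.centralizer {y}) =
      Nat.card {x : G // p ∣ orderOf x ∧ x ∈ Subgroup.centralizer {y}} +
      Nat.card {x : G // ¬ p ∣ orderOf x ∧ x ∈ Subgroup.centralizer {y}} := by
    have := Fintype.ofFinite G
    rw [Nat.card_eq_fintype_card, Nat.card_eq_fintype_card, Nat.card_eq_fintype_card,
      Fintype.card_subtype, Fintype.card_subtype, Fintype.card_subtype,
      ← Finset.card_filter_add_card_filter_not (fun x ↦ p ∣ orderOf x), Finset.filter_filter,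
      Finset.filter_filter]
    congr 2 <;> exact Finset.filter_congr fun _ _ ↦ and_comm
  have h3 := (Nat.mul_le_mul_left _ hpy).trans h1
  obtain ⟨q, rfl⟩ : ∃ q, p = q + 1 := ⟨p - 1, (Nat.succ_pred hp.pos.ne').symm⟩
  rw [Nat.add_sub_cancel]
  nlinarith

theorem Subgroup.zpowers_eq_of_card_prime {G : Type*} [Group G] [Finite G] {p : ℕ} (hp : p.Prime)
    {H : Subgroup G} (hH : Nat.card H = p) {y : G} (hy : y ∈ H) (hy1 : y ≠ 1) :
    Subgroup.zpowers y = H := by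
  refine Subgroup.eq_of_le_of_card_ge (Subgroup.zpowers_le.2 hy) ?_
  have h := Subgroup.card_dvd_of_le (Subgroup.zpowers_le.2 hy)
  rw [hH, Nat.dvd_prime hp, Nat.card_zpowers, orderOf_eq_one_iff] at h
  rw [hH, Nat.card_zpowers, h.resolve_left hy1]

theorem Subgroup.centralizer_zpowers {G : Type*} [Group G] (y : G) :
    Subgroup.centralizer (Subgroup.zpowers y : Set G) = Subgroup.centralizer {y} := by
  rw [Subgroup.zpowers_eq_closure, Subgroup.centralizer_closure]

theorem card_sylow_mul_pred_mul_card_centralizer_le {G : Type*} [Group G] [Finite G] {p : ℕ}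
    [hp : Fact p.Prime] {P : Sylow p G} (hP : Nat.card P = p) :
    Nat.card (Sylow p G) * ((p - 1) * Nat.card (Subgroup.centralizer (P : Set G))) ≤
      p * Nat.card {x : G // p ∣ orderOf x} := by
  have hcard (R : Sylow p G) : Nat.card R = p := 
    (Nat.card_congr (R.equiv P).toEquiv).trans hP
  obtain ⟨y, hyP, hy1⟩ := (P : Subgroup G).bot_or_exists_ne_one.resolve_left fun h ↦ by
    have := hp.1.one_lt
    rw [← hP, h] at this
    simp at this
  have key (R : Sylow p G) : ∃ z ∈ R, z ≠ 1 ∧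
      Nat.card (Subgroup.centralizer (P : Set G)) ≤ Nat.card (Subgroup.centralizer {z}) := by
    obtain ⟨g, rfl⟩ := MulAction.exists_smul_eq G P R
    refine ⟨g * y * g⁻¹, ?_, by rwa [Ne, conj_eq_one_iff], ?_⟩
    · rw [← MulAut.conj_apply]
      exact Subgroup.smul_mem_pointwise_smul y (MulAut.conj g) (P : Subgroup G) hyP
    · have hP' := Subgroup.centralizer_zpowers y
      rw [Subgroup.zpowers_eq_of_card_prime hp.1 hP hyP hy1] at hP'
      refine (congrArg (fun H : Subgroup G ↦ Nat.card H) hP').le.trans ?_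
      refine Nat.card_le_card_of_injective (fun x ↦ ⟨g * x.1 * g⁻¹, ?_⟩) fun x x' h ↦ ?_
      · have := Subgroup.mem_centralizer_singleton_iff.1 x.2
        rw [Subgroup.mem_centralizer_singleton_iff, ← MulAut.conj_apply, ← MulAut.conj_apply,
          ← map_mul, ← map_mul, this]
      · exact Subtype.ext (mul_left_cancel (mul_right_cancel (Subtype.mk.inj h)))
  choose z hzR hz1 hzc using key
  have hz (R : Sylow p G) : Subgroup.zpowers (z R) = R :=
    Subgroup.zpowers_eq_of_card_prime hp.1 (hcard R) (hzR R) (hz1 R)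
  have hzp (R : Sylow p G) {x : G} (h : p ∣ orderOf x)
      (hx : x ∈ Subgroup.centralizer {z R}) :
      Subgroup.zpowers (x ^ (orderOf x / p)) = R := by
    have ho : orderOf (x ^ (orderOf x / p)) = p := orderOf_pow_orderOf_div (orderOf_pos x).ne' h
    have hN : x ^ (orderOf x / p) ∈ Subgroup.normalizer (R : Set G) := by
      refine Subgroup.centralizer_le_normalizer _ (pow_mem ?_ _)
      have := Subgroup.centralizer_zpowers (z R)
      rw [hz] at this
      rwa [← this] at hx
    have hpg : IsPGroup p (Subgroup.zpowers (x ^ (orderOf x / p))) :=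
      IsPGroup.of_card (n := 1) (by rw [Nat.card_zpowers, ho, pow_one])
    have hR := (hpg.inf_normalizer_sylow R).le ⟨Subgroup.mem_zpowers _, hN⟩
    refine Subgroup.zpowers_eq_of_card_prime hp.1 (hcard R) hR.2 fun h1 ↦ ?_
    rw [h1, orderOf_one] at ho
    exact hp.1.ne_one ho.symm
  let f : (Σ R : Sylow p G, {x : G // p ∣ orderOf x ∧ x ∈ Subgroup.centralizer {z R}}) →
      {x : G // p ∣ orderOf x} := fun w ↦ ⟨w.2.1, w.2.2.1⟩
  have hf : Function.Injective f := by
    rintro ⟨R, x, hx, hxR⟩ ⟨R', x', hx', hxR'⟩ h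
    obtain rfl : x = x' := congrArg Subtype.val h
    obtain rfl : R = R' := Sylow.ext ((hzp R hx hxR).symm.trans (hzp R' hx hxR'))
    rfl
  have := Fintype.ofFinite (Sylow p G)
  have h1 := Nat.card_le_card_of_injective f hf
  rw [Nat.card_sigma] at h1
  refine le_trans ?_ (Nat.mul_le_mul_left p h1)
  rw [Finset.mul_sum, Nat.card_eq_fintype_card (α := Sylow p G), ← Finset.card_univ,
    ← smul_eq_mul, ← Finset.sum_const]
  refine Finset.sum_le_sum fun R _ ↦ (Nat.mul_le_mul_left _ (hzc R)).trans
    (pred_mul_card_centralizer_le hp.1 (k := 1) (hz1 R) ?_)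
  rw [pow_one, ← orderOf_dvd_iff_pow_eq_one, ← Nat.card_zpowers, hz, hcard]

theorem centralizer_eq_bot_of_forall_isSolvable_quotient {G : Type*} [Group G]
    (hG : ¬ Group.IsSolvable G)
    (hmin : ∀ N : Subgroup G, ∀ [N.Normal], N ≠ ⊥ → Group.IsSolvable (G ⧸ N))
    (K : Subgroup G) [K.Normal] (hK : K ≠ ⊥) : Subgroup.centralizer (K : Set G) = ⊥ := by
  by_contra hC
  have h1 := hmin K hK
  have h2 := hmin _ hC
  let C := Subgroup.centralizer (K : Set G)
  let f : G →* (G ⧸ K) × (G ⧸ C) := (QuotientGroup.mk' K).prod (QuotientGroup.mk' C)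
  have : Group.IsSolvable (K ⊓ C : Subgroup G) := Group.isSolvable_of_comm fun a b ↦
    Subtype.ext (Subgroup.mem_centralizer_iff.1 b.2.2 a a.2.1)
  refine hG (Group.isSolvable_of_ker_le_range (K ⊓ C).subtype f fun x hx ↦ ?_)
  rw [MonoidHom.mem_ker, MonoidHom.prod_apply, Prod.mk_eq_one, ← MonoidHom.mem_ker,
    ← MonoidHom.mem_ker, QuotientGroup.ker_mk', QuotientGroup.ker_mk'] at hx
  exact ⟨⟨x, hx⟩, rfl⟩

theorem card_dvd_factorial_index_centralizer {G : Type*} [Group G] [Finite G]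
    (hG : ¬ Group.IsSolvable G)
    (hmin : ∀ N : Subgroup G, ∀ [N.Normal], N ≠ ⊥ → Group.IsSolvable (G ⧸ N))
    {y : G} (hy : y ≠ 1) : Nat.card G ∣ (Subgroup.centralizer {y}).index.factorial := by
  let H := Subgroup.centralizer {y}
  have hcore : H.normalCore = ⊥ := by
    by_contra h
    have h1 := centralizer_eq_bot_of_forall_isSolvable_quotient hG hmin _ h
    refine hy ((Subgroup.eq_bot_iff_forall _).1 h1 y ?_)
    rw [Subgroup.mem_centralizer_iff]
    exact fun x hx ↦ Subgroup.mem_centralizer_singleton_iff.1 (H.normalCore_le hx)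
  rw [Subgroup.normalCore_eq_ker] at hcore
  have := Subgroup.card_dvd_of_injective _ ((MonoidHom.ker_eq_bot_iff _).1 hcore)
  rwa [Nat.card_perm] at this

theorem Nat.Prime.two_mul_le_of_sq_dvd_factorial {p m : ℕ} (hp : p.Prime)
    (h : p ^ 2 ∣ m.factorial) : 2 * p ≤ m := by
  by_contra! hm
  have hlog : Nat.log p m < 2 := by
    refine Nat.log_lt_of_lt_pow' two_ne_zero ?_
    have := hp.two_le
    nlinarith
  rw [hp.pow_dvd_factorial_iff hlog] at h
  simp only [Nat.Ico_succ_singleton, Finset.sum_singleton, pow_one] at h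
  have := (Nat.le_div_iff_mul_le hp.pos).1 h
  omega

theorem not_sq_dvd_card_of_le_alpha {G : Type*} [Group G] [Fintype G]
    (hG : ¬ Group.IsSolvable G)
    (hmin : ∀ N : Subgroup G, ∀ [N.Normal], N ≠ ⊥ → Group.IsSolvable (G ⧸ N))
    (h : 67 / 120 ≤ alpha G) {p : ℕ} (hp : p.Prime) (hp5 : 5 ≤ p) : ¬ p ^ 2 ∣ Nat.card G := by
  intro hdvd
  have := Fact.mk hp
  obtain ⟨A, hA⟩ := Sylow.exists_subgroup_card_pow_prime p hdvd
  have hcomm : ∀ a ∈ A, ∀ b ∈ A, a * b = b * a := fun a ha b hb ↦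
    congrArg Subtype.val ((IsPGroup.commGroupOfCardEqPrimeSq hA).mul_comm ⟨a, ha⟩ ⟨b, hb⟩)
  have hA1 : 1 < p ^ 2 := Nat.one_lt_pow two_ne_zero hp.one_lt
  let S : Finset A := Finset.univ.erase 1
  have hS : S.card = p ^ 2 - 1 := by
    rw [Finset.card_erase_of_mem (Finset.mem_univ _), Finset.card_univ, ← Nat.card_eq_fintype_card,
      hA]
  obtain ⟨a, haS, ha⟩ := S.exists_max_image (fun a ↦ Nat.card (Subgroup.centralizer {(a : G)}))
    (Finset.card_pos.1 (by omega))
  have ha1 : (a : G) ≠ 1 := fun h ↦ (Finset.mem_erase.1 haS).1 (Subtype.ext h)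
  have hm := (hp.two_mul_le_of_sq_dvd_factorial
    (hdvd.trans (card_dvd_factorial_index_centralizer hG hmin ha1)))
  have hc := Subgroup.card_mul_index (Subgroup.centralizer {(a : G)})
  have hc0 : 0 < Nat.card (Subgroup.centralizer {(a : G)}) := Nat.card_pos
  have hI := card_sq_eq_one_mul_card_le A hcomm
  rw [← Finset.add_sum_erase _ _ (Finset.mem_univ 1), hA] at hI
  replace hI := hI.trans (Nat.add_le_add (Subgroup.card_le_card_group _) (Finset.sum_le_card_nsmul S _ _ ha))
  rw [hS, smul_eq_mul] at hI
  have hJ := pred_mul_card_centralizer_le hp (k := 2) ha1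
    (by rw [← hA]; exact congrArg Subtype.val (pow_card_eq_one' (x := a)))
  have hJ' : Nat.card {x : G // p ∣ orderOf x ∧ x ∈ Subgroup.centralizer {(a : G)}} ≤
      Nat.card {x : G // p ∣ orderOf x} :=
    Nat.card_le_card_of_injective (fun x ↦ ⟨x.1, x.2.1⟩) fun x x' h ↦
      Subtype.ext (Subtype.mk.inj h)
  have hα := card_le_card_sq_eq_one_of_le_alpha h hp hp5
  rw [← hc] at hα hI
  generalize Nat.card (Subgroup.centralizer {(a : G)}) = c at *
  generalize (Subgroup.centralizer {(a : G)}).index = m at *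
  generalize Nat.card {x : G // p ∣ orderOf x} = J at *
  generalize Nat.card {x : G // x ^ 2 = 1} = I at *
  replace hJ := hJ.trans (Nat.mul_le_mul_left _ hJ')
  zify [hp.one_le, hA1.le] at *
  have h1 : (7 * p ^ 2 * m + 30 * p * (p - 1)) * c ≤ (60 * m + 60 * (p ^ 2 - 1) : ℤ) * c := by
    nlinarith
  have h2 := le_of_mul_le_mul_right h1 hc0
  have h3 : 0 ≤ ((m : ℤ) - 2 * p) * (7 * p ^ 2 - 60) :=
    mul_nonneg (by linarith) (by nlinarith)
  nlinarith [mul_nonneg (sq_nonneg (p : ℤ)) (sub_nonneg.2 hp5)]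

theorem eq_five_of_card_bounds {p n e c I J : ℕ} (hp5 : 5 ≤ p) (hp6 : p ≠ 6) (hn : p + 1 ≤ n)
    (he : e ≤ p - 1) (hc : 0 < c) (hI : I * p ≤ n * (e * c) + (p - 1) * c)
    (hJ : n * ((p - 1) * c) ≤ p * J) (hα : 7 * (n * (e * c)) + 30 * J ≤ 60 * I) :
    p = 5 ∧ e = 4 ∧ n ≤ 12 := by
  obtain ⟨q, rfl⟩ : ∃ q, p = q + 5 := ⟨p - 5, by omega⟩
  simp only [show q + 5 - 1 = q + 4 by omega] at *
  have h1 : (7 * (n * e) * (q + 5) + 30 * n * (q + 4)) * c ≤ (60 * (n * e) + 60 * (q + 4)) * c := by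
    nlinarith
  have h2 := Nat.le_of_mul_le_mul_right h1 hc
  have h3 : n * e ≤ n * (q + 4) := Nat.mul_le_mul_left n he
  rcases Nat.lt_or_ge q 4 with hq | hq
  · interval_cases q
    · refine ⟨rfl, ?_, by omega⟩
      interval_cases e <;> omega
    · omega
    · omega
    · omega
  · exfalso
    nlinarith [Nat.zero_le (n * e * (q - 4)), Nat.mul_le_mul_left (n * e) hq]

theorem exists_sylow_card_eq_prime {G : Type*} [Group G] [Fintype G] (hG : ¬ Group.IsSolvable G)
    (hmin : ∀ N : Subgroup G, ∀ [N.Normal], N ≠ ⊥ → Group.IsSolvable (G ⧸ N))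
    (h : 67 / 120 ≤ alpha G) {p : ℕ} [hp : Fact p.Prime] (hp5 : 5 ≤ p) (hdvd : p ∣ Nat.card G)
    (P : Sylow p G) : p = 5 ∧ Nat.card P = p ∧ Nat.card (Sylow p G) ≤ 12 ∧ 1 < Nat.card (Sylow p G) ∧
      Nat.card G = Nat.card (Sylow p G) * (4 * Nat.card (Subgroup.centralizer (P : Set G))) := by
  have hP : Nat.card P = p := by
    obtain ⟨k, hk⟩ := P.2.exists_card_eq
    have h1 := P.dvd_card_of_dvd_card hdvd
    rcases k with _ | _ | k
    · rw [hk, pow_zero, Nat.dvd_one] at h1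
      exact absurd h1 hp.1.ne_one
    · rw [hk, zero_add, pow_one]
    · refine absurd ?_ (not_sq_dvd_card_of_le_alpha hG hmin h hp.1 hp5)
      exact ((pow_dvd_pow p (by omega)).trans hk.symm.dvd).trans (Subgroup.card_subgroup_dvd_card _)
  have hcyc : IsCyclic P := isCyclic_of_prime_card hP
  have hPC : (P : Subgroup G) ≤ Subgroup.centralizer (P : Set G) := P.le_centralizer
  have hP1 : (P : Subgroup G) ≠ ⊥ := fun h ↦ by
    rw [h, Subgroup.card_bot] at hP
    exact hp.1.ne_one hP.symm
  have hn1 : Nat.card (Sylow p G) ≠ 1 := fun h1 ↦ by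
    have := (Nat.card_eq_one_iff_unique.1 h1).1
    have := P.normal_of_subsingleton
    exact hP1 (le_bot_iff.1 (hPC.trans
      (centralizer_eq_bot_of_forall_isSolvable_quotient hG hmin (P : Subgroup G) hP1).le))
  have hn : p + 1 ≤ Nat.card (Sylow p G) := by
    have h1 := (Nat.modEq_iff_dvd' Nat.card_pos).1 (card_sylow_modEq_one p G).symm
    have h2 : 0 < Nat.card (Sylow p G) := Nat.card_pos
    have := Nat.le_of_dvd (by omega) h1
    omega
  have he : (Subgroup.centralizer (P : Set G)).relIndex (Subgroup.normalizer (P : Set G)) ≤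
      p - 1 := by
    have key := Subgroup.card_dvd_of_injective _
      (QuotientGroup.kerLift_injective (P : Subgroup G).normalizerMonoidHom)
    rw [Subgroup.normalizerMonoidHom_ker, ← Subgroup.index, ← Subgroup.relIndex,
      IsCyclic.card_mulAut, hP, Nat.totient_prime hp.1] at key
    exact Nat.le_of_dvd (by omega) key
  have hcard : Nat.card G = Nat.card (Sylow p G) * ((Subgroup.centralizer (P : Set G)).relIndex
      (Subgroup.normalizer (P : Set G)) * Nat.card (Subgroup.centralizer (P : Set G))) := by
    rw [P.card_eq_index_normalizer, ← Subgroup.card_mul_index (Subgroup.centralizer (P : Set G)),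
      ← Subgroup.relIndex_mul_index (Subgroup.centralizer_le_normalizer (P : Set G))]
    ring
  have hI := card_sq_eq_one_mul_card_le (P : Subgroup G) fun a ha b hb ↦
    (Subgroup.mem_centralizer_iff.1 (hPC hb) a ha)
  rw [← Finset.add_sum_erase _ _ (Finset.mem_univ 1), hP] at hI
  replace hI := hI.trans (Nat.add_le_add (Subgroup.card_le_card_group _)
    (Finset.sum_le_card_nsmul _ _ (Nat.card (Subgroup.centralizer (P : Set G))) fun a ha ↦ by
      rw [← Subgroup.centralizer_zpowers, Subgroup.zpowers_eq_of_card_prime hp.1 hP a.2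
        fun h ↦ (Finset.mem_erase.1 ha).1 (Subtype.ext h)]; rfl))
  rw [Finset.card_erase_of_mem (Finset.mem_univ _), Finset.card_univ, ← Nat.card_eq_fintype_card,
    hP, smul_eq_mul] at hI
  have hα := card_le_card_sq_eq_one_of_le_alpha h hp.1 hp5
  rw [hcard] at hI hα
  obtain ⟨h5, h4, hn12⟩ := eq_five_of_card_bounds hp5 (by rintro rfl; exact absurd hp.1 (by decide))
    hn he Nat.card_pos hI (card_sylow_mul_pred_mul_card_centralizer_le hP) hα
  exact ⟨h5, hP, hn12, by omega, by rw [← h4]; exact hcard⟩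

theorem card_sylow_five {G : Type*} [Group G] [Fintype G] (hG : ¬ Group.IsSolvable G)
    (hmin : ∀ N : Subgroup G, ∀ [N.Normal], N ≠ ⊥ → Group.IsSolvable (G ⧸ N))
    (h : 67 / 120 ≤ alpha G) [Fact (Nat.Prime 5)] :
    Nat.card (Sylow 5 G) = 6 ∧ ∀ P : Sylow 5 G, Nat.card P = 5 ∧
      Nat.card G = 24 * Nat.card (Subgroup.centralizer (P : Set G)) := by
  have h5 {p : ℕ} (hp : p.Prime) (hp5 : 5 ≤ p) (hdvd : p ∣ Nat.card G) : p = 5 := by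
    have := Fact.mk hp
    exact (exists_sylow_card_eq_prime hG hmin h hp5 hdvd (default : Sylow p G)).1
  have hdvd : 5 ∣ Nat.card G := by
    by_contra hdvd
    refine hG (Group.isSolvable_of_prime_dvd_card Nat.prime_two Nat.prime_three _ G rfl
      fun r hr hrG ↦ ?_)
    have h6 : ¬ 5 ≤ r := fun hr5 ↦ hdvd (h5 hr hr5 hrG ▸ hrG)
    have := hr.two_le
    interval_cases r
    · exact .inl rfl
    · exact .inr rfl
    · exact absurd hr (by decide)
  have key (P : Sylow 5 G) := exists_sylow_card_eq_prime hG hmin h le_rfl hdvd P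
  have h6 : Nat.card (Sylow 5 G) = 6 := by
    obtain ⟨-, -, h12, h1, hcard⟩ := key default
    have hmod := card_sylow_modEq_one 5 G
    have h11 : Nat.card (Sylow 5 G) ≠ 11 := fun h11 ↦ by
      rw [h11] at hcard
      exact absurd (h5 (by norm_num : Nat.Prime 11) (by norm_num) (hcard ▸ dvd_mul_right _ _))
        (by norm_num)
    rw [Nat.ModEq] at hmod
    omega
  refine ⟨h6, fun P ↦ ⟨(key P).2.1, ?_⟩⟩
  rw [(key P).2.2.2.2, h6]
  ring

theorem Sylow.eq_of_le_normalizer {G : Type*} [Group G] [Finite G] {p : ℕ}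
    [Fact p.Prime] {P R : Sylow p G}
    (h : (P : Subgroup G) ≤ Subgroup.normalizer (R : Set G)) : P = R := by
  have h1 := P.2.inf_normalizer_sylow R
  rw [inf_eq_left.2 h] at h1
  exact Sylow.ext ((P.3 R.2 (inf_eq_left.1 h1.symm)).symm)

theorem toPermHom_sylow_injective {G : Type*} [Group G] [Finite G] (hG : ¬ Group.IsSolvable G)
    (hmin : ∀ N : Subgroup G, ∀ [N.Normal], N ≠ ⊥ → Group.IsSolvable (G ⧸ N))
    {p : ℕ} [hp : Fact p.Prime] (h1 : 1 < Nat.card (Sylow p G))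
    (P : Sylow p G) (hP : Nat.card P = p) :
    Function.Injective (MulAction.toPermHom G (Sylow p G)) := by
  rw [← MonoidHom.ker_eq_bot_iff]
  by_contra hK
  set K := (MulAction.toPermHom G (Sylow p G)).ker
  have hKN {x : G} (hx : x ∈ K) (R : Sylow p G) : x ∈ Subgroup.normalizer (R : Set G) := by
    rw [← Sylow.smul_eq_iff_mem_normalizer]
    exact congrArg (· R) (MonoidHom.mem_ker.1 hx)
  have hdisj : ∀ x ∈ (P : Subgroup G), x ∈ K → x = 1 := by
    intro x hxP hxK
    by_contra hx1
    have hPK : (P : Subgroup G) ≤ K := by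
      rw [← Subgroup.zpowers_eq_of_card_prime hp.1 hP hxP hx1]
      exact Subgroup.zpowers_le.2 hxK
    have : Subsingleton (Sylow p G) := ⟨fun R R' ↦ by
      rw [← Sylow.eq_of_le_normalizer (hPK.trans fun x hx ↦ hKN hx R),
        ← Sylow.eq_of_le_normalizer (hPK.trans fun x hx ↦ hKN hx R')]⟩
    exact (Nat.card_of_subsingleton P ▸ h1).false
  have hC := centralizer_eq_bot_of_forall_isSolvable_quotient hG hmin K hK
  have hPC : (P : Subgroup G) ≤ Subgroup.centralizer (K : Set G) := by
    intro x hx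
    rw [Subgroup.mem_centralizer_iff_commutator_eq_one]
    intro k hk
    refine hdisj _ ?_ ?_
    · rw [commutatorElement_def]
      refine mul_mem ?_ (inv_mem hx)
      exact (Subgroup.mem_set_normalizer_iff.1 (hKN hk P) x).1 hx
    · rw [commutatorElement_def, mul_assoc, mul_assoc]
      refine mul_mem hk ?_
      rw [← mul_assoc]
      exact (inferInstance : K.Normal).conj_mem _ (inv_mem hk) x
  have hbot : (P : Subgroup G) = ⊥ := le_bot_iff.1 (hPC.trans hC.le)
  rw [hbot, Subgroup.card_bot] at hP
  exact hp.1.ne_one hP.symm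

theorem card_centralizer_sylow_le {G : Type*} [Group G] [Finite G] {p : ℕ} [hp : Fact p.Prime]
    (hinj : Function.Injective (MulAction.toPermHom G (Sylow p G)))
    (hn : Nat.card (Sylow p G) = p + 1) (P : Sylow p G) (hP : Nat.card P = p) :
    Nat.card (Subgroup.centralizer (P : Set G)) ≤ p := by
  have hfix (R : Sylow p G) (hR : R ≠ P) :
      Function.Injective fun x : P ↦ (x : G) • R := by
    intro x x' h
    by_contra hne
    refine hR (Sylow.eq_of_le_normalizer ?_).symm
    have h1 : ((x' : G)⁻¹ * x) • R = R := by rw [mul_smul, inv_smul_eq_iff]; exact h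
    rw [← Subgroup.zpowers_eq_of_card_prime hp.1 hP (mul_mem (inv_mem x'.2) x.2)
      fun h ↦ hne (Subtype.ext (inv_mul_eq_one.1 h).symm)]
    exact Subgroup.zpowers_le.2 (Sylow.smul_eq_iff_mem_normalizer.1 h1)
  have hself {x : G} (hx : x ∈ Subgroup.centralizer (P : Set G)) : x • P = P :=
    Sylow.smul_eq_iff_mem_normalizer.2 (Subgroup.centralizer_le_normalizer _ hx)
  have hPself {x : G} (hx : x ∈ P) : x • P = P :=
    Sylow.smul_eq_iff_mem_normalizer.2 (Subgroup.le_normalizer hx)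
  have hne {x : G} (hx : x • P = P) {R : Sylow p G} (hR : R ≠ P) : x • R ≠ P := fun h ↦
    hR (smul_left_cancel x (h.trans hx.symm))
  have hcompl : Nat.card {R : Sylow p G // R ≠ P} = p := by
    have := Fintype.ofFinite (Sylow p G)
    rw [Nat.card_eq_fintype_card] at hn ⊢
    rw [Fintype.card_subtype_compl, hn, Fintype.card_subtype_eq, Nat.add_sub_cancel]
  obtain ⟨R, hR⟩ : Nonempty {R : Sylow p G // R ≠ P} :=
    (Nat.card_pos_iff.1 (by rw [hcompl]; exact hp.1.pos)).1
  have htrans (R' : Sylow p G) (hR' : R' ≠ P) : ∃ x ∈ P, x • R = R' := by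
    let f : P → {R : Sylow p G // R ≠ P} := fun x ↦ ⟨(x : G) • R, hne (hPself x.2) hR⟩
    have hf : Function.Bijective f := by
      rw [Nat.bijective_iff_injective_and_card]
      exact ⟨fun x x' h ↦ hfix R hR (Subtype.mk.inj h), hP.trans hcompl.symm⟩
    obtain ⟨x, hx⟩ := hf.2 ⟨R', hR'⟩
    exact ⟨x, x.2, Subtype.mk.inj hx⟩
  refine le_trans ?_ hcompl.le
  refine Nat.card_le_card_of_injective (fun x ↦ ⟨(x : G) • R, hne (hself x.2) hR⟩) fun x x' h ↦ ?_
  have h1 : ((x' : G)⁻¹ * x) • R = R := by rw [mul_smul, inv_smul_eq_iff]; exact Subtype.mk.inj h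
  have hC := mul_mem (inv_mem x'.2) x.2
  refine Subtype.ext (inv_mul_eq_one.1 (hinj ?_)).symm
  rw [map_one]
  ext1 R'
  rw [MulAction.toPermHom_apply, MulAction.toPerm_apply, Equiv.Perm.one_apply]
  by_cases hR' : R' = P
  · rw [hR', hself hC]
  · obtain ⟨y, hy, rfl⟩ := htrans R' hR'
    rw [← mul_smul, ← Subgroup.mem_centralizer_iff.1 hC y hy, mul_smul, h1]

theorem Equiv.Perm.nonempty_mulEquiv_perm_fin_five {α : Type*} [Fintype α] [DecidableEq α]
    (hα : Nat.card α = 6) (H : Subgroup (Equiv.Perm α)) (hH : Nat.card H = 120) :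
    Nonempty (H ≃* Equiv.Perm (Fin 5)) := by
  have hS : Nat.card (Equiv.Perm α) = 720 := by rw [Nat.card_perm, hα]; rfl
  have hidx : Nat.card (Equiv.Perm α ⧸ H) = 6 := by
    have := H.card_mul_index
    rw [hS, hH, Subgroup.index] at this
    omega
  have hinj : Function.Injective (MulAction.toPermHom (Equiv.Perm α) (Equiv.Perm α ⧸ H)) := by
    rw [← MonoidHom.ker_eq_bot_iff, ← Subgroup.normalCore_eq_ker]
    by_contra hne
    have := (Subgroup.nontrivial_iff_ne_bot _).2 hne
    have hA := Equiv.Perm.alternatingGroup_le_of_normal (α := α) (by omega) (N := H.normalCore) this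
    have h1 := Subgroup.card_le_of_le (hA.trans H.normalCore_le)
    have : Nontrivial α := Finite.one_lt_card_iff_nontrivial.1 (by omega)
    have h2 := two_mul_nat_card_alternatingGroup (α := α)
    omega
  let a : Equiv.Perm α ⧸ H := (1 : Equiv.Perm α)
  have hstab (x : H) : (x : Equiv.Perm α) • a = a := by
    have := MulAction.stabilizer_quotient H
    rw [← MulAction.mem_stabilizer_iff]
    exact this.ge x.2
  have hb : Nat.card {b : Equiv.Perm α ⧸ H // b ≠ a} = 5 := by
    rw [Nat.card_eq_fintype_card] at hidx ⊢
    rw [Fintype.card_subtype_compl, hidx, Fintype.card_subtype_eq]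
  let f : H →* Equiv.Perm {b : Equiv.Perm α ⧸ H // b ≠ a} :=
    { toFun := fun x ↦ (MulAction.toPerm (x : Equiv.Perm α)).subtypePerm fun b ↦ by
        rw [MulAction.toPerm_apply, ne_eq, ne_eq, not_iff_not]
        nth_rw 1 [← hstab x]
        exact (smul_left_cancel_iff _)
      map_one' := by ext; simp
      map_mul' := fun x y ↦ Equiv.ext fun b ↦ Subtype.ext (mul_smul (x : Equiv.Perm α) y b.1) }
  have hf : Function.Injective f := by
    refine (injective_iff_map_eq_one f).2 fun x hx ↦ Subtype.ext (hinj ?_)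
    rw [OneMemClass.coe_one, map_one]
    ext b
    rw [MulAction.toPermHom_apply, MulAction.toPerm_apply, Equiv.Perm.one_apply]
    by_cases hba : b = a
    · rw [hba, hstab]
    · exact congrArg Subtype.val (Equiv.congr_fun hx ⟨b, hba⟩)
  have hbij : Function.Bijective f := by
    rw [Nat.bijective_iff_injective_and_card, hH, Nat.card_perm, hb]
    exact ⟨hf, rfl⟩
  exact ⟨(MulEquiv.ofBijective f hbij).trans (Equiv.permCongrHom (Finite.equivFinOfCardEq hb))⟩

theorem nonempty_mulEquiv_perm_fin_five_of_le_alpha {G : Type*} [Group G] [Fintype G]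
    (hG : ¬ Group.IsSolvable G)
    (hmin : ∀ N : Subgroup G, ∀ [N.Normal], N ≠ ⊥ → Group.IsSolvable (G ⧸ N))
    (h : 67 / 120 ≤ alpha G) : Nonempty (G ≃* Equiv.Perm (Fin 5)) := by
  have : Fact (Nat.Prime 5) := ⟨Nat.prime_five⟩
  have : Fintype (Sylow 5 G) := Fintype.ofFinite _
  obtain ⟨h6, hP⟩ := card_sylow_five hG hmin h
  let P : Sylow 5 G := default
  obtain ⟨hP5, hcard⟩ := hP P
  have : IsCyclic P := isCyclic_of_prime_card hP5
  have hinj := toPermHom_sylow_injective hG hmin (by omega) P hP5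
  have hC := card_centralizer_sylow_le hinj h6 P hP5
  have hC5 : Nat.card P ≤ Nat.card (Subgroup.centralizer (P : Set G)) := Subgroup.card_le_of_le
    P.le_centralizer
  let e := MonoidHom.ofInjective hinj
  obtain ⟨e'⟩ := Equiv.Perm.nonempty_mulEquiv_perm_fin_five h6 _
    (show Nat.card (MulAction.toPermHom G (Sylow 5 G)).range = 120 by
      rw [← Nat.card_congr e.toEquiv, hcard]
      omega)
  exact ⟨e.trans e'⟩

theorem commute_of_sq_eq_one {G : Type*} [Group G] {a b : G} (ha : a ^ 2 = 1) (hb : b ^ 2 = 1)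
    (hab : (a * b) ^ 2 = 1) : Commute a b := by
  rw [sq] at *
  have := eq_inv_of_mul_eq_one_left hab
  rwa [mul_inv_rev, ← eq_inv_of_mul_eq_one_left ha, ← eq_inv_of_mul_eq_one_left hb] at this

theorem nonempty_mulEquiv_pi_zmod_two {N : Type*} [Group N] [Finite N] (hN : ∀ x : N, x ^ 2 = 1) :
    ∃ n : ℕ, Nonempty (N ≃* (Fin n → Multiplicative (ZMod 2))) := by
  let : CommGroup N := CommGroup.mk fun a b ↦ commute_of_sq_eq_one (hN a) (hN b) (hN (a * b))
  let : Module (ZMod 2) (Additive N) := AddCommGroup.zmodModule fun x ↦ hN x.toMul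
  exact ⟨_, ⟨{
    toFun := fun x i ↦ Multiplicative.ofAdd
      ((Module.finBasis (ZMod 2) (Additive N)).equivFun (Additive.ofMul x) i)
    invFun := fun f ↦ ((Module.finBasis (ZMod 2) (Additive N)).equivFun.symm
      fun i ↦ (f i).toAdd).toMul
    left_inv := fun x ↦ by simp
    right_inv := fun f ↦ funext fun i ↦ congrFun ((Module.finBasis (ZMod 2)
      (Additive N)).equivFun.apply_symm_apply fun i ↦ (f i).toAdd) i
    map_mul' := fun x y ↦ by ext i; simp }⟩⟩

theorem closure_inf_ker_eq_bot_of_conj_swap {G α : Type*} [Group G] [DecidableEq α]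
    (π : G →* Equiv.Perm α) (t : α → α → G) (hπ : ∀ a b, π (t a b) = Equiv.swap a b)
    (hself : ∀ a, t a a = 1) (hsymm : ∀ a b, t a b = t b a) (hsq : ∀ a b, t a b * t a b = 1)
    (hconj : ∀ g a b, g * t a b * g⁻¹ = t (π g a) (π g b)) (S : Finset α) :
    ∀ x ∈ Subgroup.closure {x | ∃ a ∈ S, ∃ b ∈ S, t a b = x}, π x = 1 → x = 1 := by
  have hswap (a b c d : α) :
      t a b * t c d = t c d * t (Equiv.swap c d a) (Equiv.swap c d b) := by
    have hinv : (t c d)⁻¹ = t c d := inv_eq_of_mul_eq_one_left (hsq c d)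
    rw [← hπ, ← hconj, hinv, ← mul_assoc, ← mul_assoc, hsq, one_mul]
  induction S using Finset.induction_on with
  | empty => simp
  | insert m S hm ih =>
    set K := Subgroup.closure {x | ∃ a ∈ S, ∃ b ∈ S, t a b = x}
    have htK {a b : α} (ha : a ∈ S) (hb : b ∈ S) : t a b ∈ K :=
      Subgroup.subset_closure ⟨a, ha, b, hb, rfl⟩
    have hfix {k : G} (hk : k ∈ K) : π k m = m := by
      induction hk using Subgroup.closure_induction with
      | mem x hx =>
        obtain ⟨a, ha, b, hb, rfl⟩ := hx
        rw [hπ, Equiv.swap_apply_of_ne_of_ne] <;> (rintro rfl; contradiction)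
      | one => simp
      | mul x y _ _ hx hy => rw [map_mul, Equiv.Perm.mul_apply, hy, hx]
      | inv x _ hx => rw [map_inv, Equiv.Perm.inv_eq_iff_eq, hx]
    have step {a b c : α} (ha : a ∈ insert m S) (hb : b ∈ insert m S) (hc : c ∈ insert m S)
        {k : G} (hk : k ∈ K) : ∃ k' ∈ K, ∃ a' ∈ insert m S, k * t a m * t b c = k' * t a' m := by
      have hm' := Finset.mem_insert_self m S
      have hbm {b : α} (hb : b ∈ S) :
          ∃ k' ∈ K, ∃ a' ∈ insert m S, k * t a m * t b m = k' * t a' m := by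
        rcases Finset.mem_insert.1 ha with ham | ha
        · exact ⟨k, hk, b, Finset.mem_insert_of_mem hb, by rw [ham, hself, mul_one]⟩
        · by_cases hab : a = b
          · exact ⟨k, hk, m, hm', by rw [hab, mul_assoc, hsq, hself]⟩
          · refine ⟨k * t b a, mul_mem hk (htK hb ha), a, Finset.mem_insert_of_mem ha, ?_⟩
            rw [mul_assoc, mul_assoc, hswap b a a m, Equiv.swap_apply_left,
              Equiv.swap_apply_of_ne_of_ne (Ne.symm hab) (by rintro rfl; contradiction)]
      rcases Finset.mem_insert.1 hb with hb | hb <;> rcases Finset.mem_insert.1 hc with hc | hc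
      · exact ⟨k, hk, a, ha, by rw [hb, hc, hself, mul_one]⟩
      · rw [hb, hsymm m c]; exact hbm hc
      · rw [hc]; exact hbm hb
      · refine ⟨k * t b c, mul_mem hk (htK hb hc), Equiv.swap b c a, ?_, ?_⟩
        · rw [Equiv.swap_apply_def]
          split_ifs <;> simp_all
        · rw [mul_assoc, hswap, Equiv.swap_apply_of_ne_of_ne (a := b) (b := c) (x := m)
            (by rintro rfl; contradiction) (by rintro rfl; contradiction), mul_assoc]
    have hdecomp {x : G} (hx : x ∈ Subgroup.closure {x | ∃ a ∈ insert m S, ∃ b ∈ insert m S,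
        t a b = x}) : ∃ k ∈ K, ∃ a ∈ insert m S, x = k * t a m := by
      induction hx using Subgroup.closure_induction_right with
      | one => exact ⟨1, one_mem K, m, Finset.mem_insert_self m S, by rw [hself, mul_one]⟩
      | mul_right x y _ hy hx =>
        obtain ⟨k, hk, a, ha, rfl⟩ := hx
        obtain ⟨b, hb, c, hc, rfl⟩ := hy
        exact step ha hb hc hk
      | mul_inv_cancel x y _ hy hx =>
        obtain ⟨k, hk, a, ha, rfl⟩ := hx
        obtain ⟨b, hb, c, hc, rfl⟩ := hy
        rw [inv_eq_of_mul_eq_one_left (hsq b c)]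
        exact step ha hb hc hk
    intro x hx hx1
    obtain ⟨k, hk, a, -, rfl⟩ := hdecomp hx
    have h1 := Equiv.congr_fun hx1 a
    rw [map_mul, Equiv.Perm.mul_apply, hπ, Equiv.swap_apply_left, hfix hk,
      Equiv.Perm.one_apply] at h1
    rw [← h1, hself, mul_one] at hx1 ⊢
    exact ih k hk hx1

theorem Equiv.Perm.exists_sq_eq_one_and_inv_mul_sq_eq_one (σ : Equiv.Perm (Fin 5)) :
    ∃ ρ : Equiv.Perm (Fin 5), ρ ^ 2 = 1 ∧ (ρ⁻¹ * σ) ^ 2 = 1 ∧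
      (Commute σ (Equiv.swap 0 1) → Commute ρ (Equiv.swap 0 1)) := by
  unfold Commute SemiconjBy
  revert σ
  decide +kernel

section InvolutionLifting

variable {G : Type*} [Group G] {π : G →* Equiv.Perm (Fin 5)}

theorem ker_le_center_of_sq_eq_one_lift (hπ : Function.Surjective π)
    (hsq : ∀ x, π x ^ 2 = 1 → x ^ 2 = 1) : π.ker ≤ Subgroup.center G := by
  intro z hz
  have hz1 : π z = 1 := hz
  have key {r : G} (hr : π r ^ 2 = 1) : Commute r z :=
    commute_of_sq_eq_one (hsq r hr) (hsq z (by simp [hz1])) (hsq _ (by simp [hz1, hr]))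
  refine Subgroup.mem_center_iff.2 fun g ↦ ?_
  obtain ⟨ρ, h1, h2, -⟩ := Equiv.Perm.exists_sq_eq_one_and_inv_mul_sq_eq_one (π g)
  obtain ⟨r, rfl⟩ := hπ ρ
  have := (key h1).mul_left (key (r := r⁻¹ * g) (by simpa using h2))
  rwa [mul_inv_cancel_left] at this

theorem commute_of_commute_swap_of_sq_eq_one_lift (hπ : Function.Surjective π)
    (hsq : ∀ x, π x ^ 2 = 1 → x ^ 2 = 1) {τ g : G} (hτ : π τ = Equiv.swap 0 1)
    (hg : Commute (π g) (Equiv.swap 0 1)) : Commute g τ := by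
  have hτ2 : π τ ^ 2 = 1 := by rw [hτ, sq, Equiv.swap_mul_self]
  have key {r : G} (hr : π r ^ 2 = 1) (hrs : Commute (π r) (Equiv.swap 0 1)) : Commute r τ :=
    commute_of_sq_eq_one (hsq r hr) (hsq τ hτ2) (hsq _ (by
      rw [map_mul, (hτ ▸ hrs : Commute (π r) (π τ)).mul_pow, hr, hτ2, one_mul]))
  obtain ⟨ρ, h1, h2, h3⟩ := Equiv.Perm.exists_sq_eq_one_and_inv_mul_sq_eq_one (π g)
  obtain ⟨r, rfl⟩ := hπ ρ
  have := (key h1 (h3 hg)).mul_left (key (r := r⁻¹ * g) (by simpa using h2) (by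
    simpa using (h3 hg).inv_left.mul_left hg))
  rwa [mul_inv_cancel_left] at this

/-- An extension of `S₅` in which all involutions lift to involutions contains a complement to the
kernel, generated by a conjugacy class of lifts of transpositions. -/
theorem exists_isCompl_ker_of_sq_eq_one_lift (hπ : Function.Surjective π)
    (hsq : ∀ x, π x ^ 2 = 1 → x ^ 2 = 1) : ∃ H : Subgroup G,
      (∀ x ∈ H, π x = 1 → x = 1) ∧ H.map π = ⊤ := by
  obtain ⟨τ, hτ⟩ := hπ (Equiv.swap 0 1)
  have huniq {x y : G} (hx : IsConj τ x) (hy : IsConj τ y) (hxy : π x = π y) : x = y := by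
    obtain ⟨g, rfl⟩ := isConj_iff.1 hx
    obtain ⟨k, rfl⟩ := isConj_iff.1 hy
    have : Commute (k⁻¹ * g) τ := by
      refine commute_of_commute_swap_of_sq_eq_one_lift hπ hsq hτ ?_
      simp only [map_mul, map_inv, hτ] at hxy ⊢
      rw [Commute, SemiconjBy, mul_assoc, mul_inv_eq_iff_eq_mul.1 hxy]
      group
    have h := this.eq
    rw [mul_assoc, inv_mul_eq_iff_eq_mul] at h
    rw [h]; group
  have hex (a b : Fin 5) : ∃ x, (a = b → x = 1) ∧ (a ≠ b → IsConj τ x) ∧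
      π x = Equiv.swap a b := by
    by_cases hab : a = b
    · exact ⟨1, fun _ ↦ rfl, fun h ↦ absurd hab h, by
        rw [map_one, hab, Equiv.swap_self]; rfl⟩
    · obtain ⟨σ, hσ⟩ := isConj_iff.1 (Equiv.Perm.isConj_swap (zero_ne_one : (0 : Fin 5) ≠ 1) hab)
      obtain ⟨g, rfl⟩ := hπ σ
      exact ⟨g * τ * g⁻¹, fun h ↦ absurd h hab, fun _ ↦ isConj_iff.2 ⟨g, rfl⟩, by simp [hτ, hσ]⟩
  choose t hself hconj ht using hex
  refine ⟨Subgroup.closure {x | ∃ a ∈ Finset.univ, ∃ b ∈ Finset.univ, t a b = x},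
    closure_inf_ker_eq_bot_of_conj_swap π t ht (fun a ↦ hself a a rfl) (fun a b ↦ ?_)
      (fun a b ↦ ?_) (fun g a b ↦ ?_) _, ?_⟩
  · by_cases hab : a = b
    · rw [hab]
    · exact huniq (hconj a b hab) (hconj b a (Ne.symm hab)) (by rw [ht, ht, Equiv.swap_comm])
  · rw [← sq]
    exact hsq _ (by rw [ht, sq, Equiv.swap_mul_self])
  · by_cases hab : a = b
    · rw [hself a b hab, hself _ _ (congrArg _ hab), mul_one, mul_inv_cancel]
    · refine huniq ((hconj a b hab).trans (isConj_iff.2 ⟨g, rfl⟩))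
        (hconj _ _ ((π g).injective.ne hab)) ?_
      rw [ht, map_mul, map_mul, ht, map_inv, Equiv.swap_apply_apply]
  · rw [eq_top_iff, ← Equiv.Perm.closure_isSwap, Subgroup.closure_le]
    rintro _ ⟨a, b, -, rfl⟩
    exact ⟨t a b, Subgroup.subset_closure ⟨a, Finset.mem_univ a, b, Finset.mem_univ b, rfl⟩, ht a b⟩

theorem nonempty_mulEquiv_perm_fin_five_prod_of_sq_eq_one_lift [Finite G]
    (hπ : Function.Surjective π) (hsq : ∀ x, π x ^ 2 = 1 → x ^ 2 = 1) :
    ∃ n : ℕ, Nonempty (G ≃* Equiv.Perm (Fin 5) × (Fin n → Multiplicative (ZMod 2))) := by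
  obtain ⟨H, hinj, hmap⟩ := exists_isCompl_ker_of_sq_eq_one_lift hπ hsq
  obtain ⟨n, ⟨e⟩⟩ := nonempty_mulEquiv_pi_zmod_two (N := π.ker) fun z ↦
    Subtype.ext (hsq z (by rw [z.2, one_pow]))
  let f : H →* Equiv.Perm (Fin 5) := π.comp H.subtype
  have hf : Function.Bijective f := by
    refine ⟨(injective_iff_map_eq_one f).2 fun x hx ↦ Subtype.ext (hinj x x.2 hx), fun σ ↦ ?_⟩
    obtain ⟨x, hx, rfl⟩ := hmap.ge (Subgroup.mem_top σ)
    exact ⟨⟨x, hx⟩, rfl⟩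
  let m : H × π.ker →* G := H.subtype.noncommCoprod π.ker.subtype fun x z ↦
    Subgroup.mem_center_iff.1 (ker_le_center_of_sq_eq_one_lift hπ hsq z.2) x
  have hm (x : H) (z : π.ker) : m (x, z) = x * z := rfl
  have hmb : Function.Bijective m := by
    refine ⟨(injective_iff_map_eq_one m).2 ?_, fun g ↦ ?_⟩
    · rintro ⟨x, z⟩ h
      rw [hm] at h
      have hx : (x : G) = 1 := hinj x x.2 (by
        rw [← map_one π, ← h, map_mul, z.2, mul_one])
      rw [hx, one_mul] at h
      exact Prod.ext (Subtype.ext hx) (Subtype.ext h)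
    · obtain ⟨x, hx⟩ := hf.2 (π g)
      refine ⟨(x, ⟨(x : G)⁻¹ * g, ?_⟩), by rw [hm, mul_inv_cancel_left]⟩
      rw [MonoidHom.mem_ker, map_mul, map_inv, ← hx]
      exact inv_mul_cancel _
  exact ⟨n, ⟨(MulEquiv.ofBijective m hmb).symm.trans ((MulEquiv.ofBijective f hf).prodCongr e)⟩⟩

end InvolutionLifting

/-- A finite non-solvable group has a non-solvable quotient all of whose proper quotients are
solvable. -/
theorem exists_normal_not_isSolvable_quotient {G : Type*} [Group G] [Finite G]
    (hG : ¬ Group.IsSolvable G) : ∃ N : Subgroup G, ∃ _ : N.Normal, ¬ Group.IsSolvable (G ⧸ N) ∧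
      ∀ M : Subgroup (G ⧸ N), ∀ [M.Normal], M ≠ ⊥ → Group.IsSolvable ((G ⧸ N) ⧸ M) := by
  obtain ⟨N, ⟨hN, hs⟩, hmax⟩ := (Set.toFinite {N : Subgroup G | ∃ _ : N.Normal,
    ¬ Group.IsSolvable (G ⧸ N)}).exists_maximal ⟨⊥, inferInstance, fun h ↦
      hG (Group.isSolvable_of_surjective (f := (QuotientGroup.quotientBot (G := G)).toMonoidHom)
        (MulEquiv.surjective _))⟩
  refine ⟨N, hN, hs, fun M _ hM ↦ ?_⟩
  by_contra hMs
  have hle : N ≤ M.comap (QuotientGroup.mk' N) := fun x hx ↦ by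
    rw [Subgroup.mem_comap, QuotientGroup.mk'_apply, (QuotientGroup.eq_one_iff x).2 hx]
    exact one_mem M
  refine hM ((Subgroup.eq_bot_iff_forall _).2 fun x hx ↦ ?_)
  obtain ⟨g, rfl⟩ := QuotientGroup.mk'_surjective N x
  refine (QuotientGroup.eq_one_iff g).2 (hmax ⟨inferInstance, fun h ↦ hMs ?_⟩ hle hx)
  exact Group.isSolvable_of_surjective (f := QuotientGroup.map (M.comap (QuotientGroup.mk' N)) M
    (QuotientGroup.mk' N) le_rfl) (QuotientGroup.map_surjective_of_surjective _ _ _ (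
      QuotientGroup.mk'_surjective M |>.comp (QuotientGroup.mk'_surjective N)) _)

theorem stmt_14 (G : Type*) [Group G] [Fintype G] (h : ¬ IsSolvable G) :
    alpha (Equiv.Perm (Fin 5)) = 67 / 120 ∧
    alpha G ≤ 67 / 120 ∧
      (alpha G = 67 / 120 ↔
        ∃ n : ℕ, Nonempty
          (G ≃* Equiv.Perm (Fin 5) × (Fin n → Multiplicative (ZMod 2)))) := by
  obtain ⟨N, _, hN, hmin⟩ := exists_normal_not_isSolvable_quotient (G := G) h
  have hle := alpha_le_alpha_quotient N
  have hiso (hα : 67 / 120 ≤ alpha G) : Nonempty (G ⧸ N ≃* Equiv.Perm (Fin 5)) :=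
    nonempty_mulEquiv_perm_fin_five_of_le_alpha hN hmin (hα.trans hle)
  have hquot (e : G ⧸ N ≃* Equiv.Perm (Fin 5)) : alpha (G ⧸ N) = 67 / 120 :=
    (alpha_congr e).trans alpha_perm_fin_five
  refine ⟨alpha_perm_fin_five, ?_, fun hα ↦ ?_, ?_⟩
  · by_contra! hlt
    obtain ⟨e⟩ := hiso hlt.le
    exact (hlt.trans_le hle).ne' (hquot e)
  · obtain ⟨e⟩ := hiso hα.ge
    refine nonempty_mulEquiv_perm_fin_five_prod_of_sq_eq_one_lift
      (π := e.toMonoidHom.comp (QuotientGroup.mk' N))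
      (e.surjective.comp (QuotientGroup.mk'_surjective N)) fun x hx ↦ ?_
    rw [← totient_orderOf_eq_one_iff,
      totient_orderOf_mk_of_alpha_eq N (hα.trans (hquot e).symm), totient_orderOf_eq_one_iff]
    exact e.injective (by simpa using hx)
  · rintro ⟨n, ⟨e⟩⟩
    rw [alpha_congr e, alpha_prod_of_forall_sq_eq_one _ _ fun v ↦ ?_, alpha_perm_fin_five]
    exact funext fun i ↦ (by decide : ∀ a : Multiplicative (ZMod 2), a ^ 2 = 1) (v i)
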